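/- arXiv:2507.10108 — 5 statements merged into one kernel-verified Lean document; each statement's English description precedes it below -/
import Mathlib

section
/- Cartan formula for the concretely defined Steenrod squares on the polynomial algebra: for every n ≥ 0 and all homogeneous polynomials f, g ∈ P_k, Sq^n(f·g) = Σ_{i=0}^{n} Sq^i(f)·Sq^{n−i}(g). -/
open MvPolynomial

noncomputable section

abbrev P (k : ℕ) := MvPolynomial (Fin k) (ZMod 2)

/-- The total Steenrod square: the `F₂`-algebra endomorphism of `P k` with
`Sq(xᵢ) = xᵢ + xᵢ²`. -/
def SqTotal (k : ℕ) : P k →ₐ[ZMod 2] P k :=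
  aeval (fun i => X i + X i ^ 2)

/-- The `n`-th Steenrod square: on a homogeneous polynomial of degree `d` it is the
degree-`(d+n)` homogeneous component of the total square, extended by linearity over
homogeneous components. -/
def Sq (k n : ℕ) (f : P k) : P k :=
  ∑ d ∈ Finset.range (f.totalDegree + 1),
    homogeneousComponent (d + n) (SqTotal k (homogeneousComponent d f))

/-- The homogeneous components of a product are the convolution of the homogeneous components. -/
theorem homogeneousComponent_mul {σ R : Type*} [CommSemiring R] (n : ℕ) (p q : MvPolynomial σ R) :
    homogeneousComponent n (p * q) = ∑ x ∈ Finset.HasAntidiagonal.antidiagonal n,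
      homogeneousComponent x.1 p * homogeneousComponent x.2 q := by
  classical
  ext d
  simp only [coeff_homogeneousComponent, coeff_sum, coeff_mul]
  rw [Finset.sum_comm, ← Finset.sum_const_zero (s := Finset.HasAntidiagonal.antidiagonal d),
    ← Finset.sum_ite_irrel]
  refine Finset.sum_congr rfl fun y hy => ?_
  have hdeg : d.degree = y.1.degree + y.2.degree := by
    rw [← Finset.HasAntidiagonal.mem_antidiagonal.mp hy, map_add]
  by_cases h : d.degree = n
  · rw [if_pos h, Finset.sum_eq_single (y.1.degree, y.2.degree)]
    · simp
    · rintro ⟨i, j⟩ - hne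
      by_cases hi : y.1.degree = i
      · have hj : y.2.degree ≠ j := fun hj => hne (by rw [hi, hj])
        simp [hj]
      · simp [hi]
    · intro hmem
      exact absurd (Finset.HasAntidiagonal.mem_antidiagonal.mpr (hdeg.symm.trans h)) hmem
  · rw [if_neg h]
    refine (Finset.sum_eq_zero ?_).symm
    rintro ⟨i, j⟩ hij
    have hij := Finset.HasAntidiagonal.mem_antidiagonal.mp hij
    by_cases hi : y.1.degree = i
    · have hj : y.2.degree ≠ j := fun hj => h (by simp_all)
      simp [hj]
    · simp [hi]

/-- The total square of a monomial is a multiple of that monomial. -/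
theorem monomial_dvd_SqTotal (k : ℕ) (d : Fin k →₀ ℕ) (r : ZMod 2) :
    monomial d r ∣ SqTotal k (monomial d r) := by
  refine ⟨∏ i, (1 + X i) ^ d i, ?_⟩
  rw [SqTotal, aeval_monomial, monomial_eq, Finsupp.prod_fintype _ _ (by simp),
    Finsupp.prod_fintype _ _ (by simp), mul_assoc, ← Finset.prod_mul_distrib]
  congr 1
  refine Finset.prod_congr rfl fun i _ => ?_
  rw [← mul_pow]
  ring

/-- The total square does not lower degrees. -/
theorem homogeneousComponent_SqTotal_eq_zero {k a m : ℕ} {f : P k} (hf : f.IsHomogeneous a)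
    (hm : m < a) : homogeneousComponent m (SqTotal k f) = 0 := by
  rw [f.as_sum, map_sum, map_sum]
  refine Finset.sum_eq_zero fun d hd => ?_
  obtain ⟨q, hq⟩ := monomial_dvd_SqTotal k d (coeff d f)
  have hda : d.degree = a := by
    by_contra h
    exact mem_support_iff.mp hd (hf.coeff_eq_zero h)
  rw [hq, homogeneousComponent_mul]
  refine Finset.sum_eq_zero fun x hx => ?_
  have hx := Finset.HasAntidiagonal.mem_antidiagonal.mp hx
  rw [homogeneousComponent_of_mem (isHomogeneous_monomial _ hda), if_neg (by omega), zero_mul]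

/-- On homogeneous polynomials `Sq` is a single component of the total square. -/
theorem Sq_of_isHomogeneous {k a : ℕ} (n : ℕ) {f : P k} (hf : f.IsHomogeneous a) :
    Sq k n f = homogeneousComponent (a + n) (SqTotal k f) := by
  by_cases h0 : f = 0
  · simp [Sq, h0]
  rw [Sq, hf.totalDegree h0, Finset.sum_eq_single a]
  · rw [homogeneousComponent_eq_self hf]
  · intro d _ hd
    rw [homogeneousComponent_of_mem hf, if_neg hd, map_zero, map_zero]
  · simp

/-- Cartan formula: `Sq^n(f·g) = Σ_{i=0}^n Sq^i(f)·Sq^{n-i}(g)` for homogeneous `f, g`. -/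
theorem cartan_formula (k : ℕ) (hk : 1 ≤ k) (n : ℕ) (a b : ℕ) (f g : P k)
    (hf : f ∈ homogeneousSubmodule (Fin k) (ZMod 2) a)
    (hg : g ∈ homogeneousSubmodule (Fin k) (ZMod 2) b) :
    Sq k n (f * g) = ∑ i ∈ Finset.range (n + 1), Sq k i f * Sq k (n - i) g := by
  rw [mem_homogeneousSubmodule] at hf hg
  rw [Sq_of_isHomogeneous n (hf.mul hg), map_mul, homogeneousComponent_mul,
    ← Finset.Nat.sum_antidiagonal_eq_sum_range_succ (fun i j => Sq k i f * Sq k j g)]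
  symm
  refine Finset.sum_of_injOn (fun x => (a + x.1, b + x.2)) ?_ ?_ ?_ ?_
  · rintro ⟨i, j⟩ - ⟨i', j'⟩ - h
    simpa using h
  · rintro ⟨i, j⟩ hij
    simp only [Finset.mem_coe, Finset.HasAntidiagonal.mem_antidiagonal] at hij ⊢
    omega
  · rintro ⟨i, j⟩ hij hnot
    rw [Finset.HasAntidiagonal.mem_antidiagonal] at hij
    by_cases hi : i < a
    · rw [homogeneousComponent_SqTotal_eq_zero hf hi, zero_mul]
    by_cases hj : j < b
    · rw [homogeneousComponent_SqTotal_eq_zero hg hj, mul_zero]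
    refine absurd ⟨(i - a, j - b), ?_, ?_⟩ hnot
    · simp only [Finset.mem_coe, Finset.HasAntidiagonal.mem_antidiagonal] at hij ⊢
      omega
    · ext <;> simp only <;> omega
  · rintro ⟨i, j⟩ -
    rw [Sq_of_isHomogeneous i hf, Sq_of_isHomogeneous j hg]
end
end

section
/- Let P_k^0 (resp. P_k^+) be the span of the monomials of P_k having at least one zero exponent (resp. having all exponents strictly positive), and set A⁺P_k^ε = Σ_{n≥1} Sq^n(P_k^ε) for ε ∈ {0,+}. Then A⁺P_k = A⁺P_k^0 ⊕ A⁺P_k^+, and for every degree d the inclusions P_k^0 ↪ P_k and P_k^+ ↪ P_k induce an isomorphism of F₂-vector spaces (QP_k)_d ≅ (P_k^0)_d/(A⁺P_k^0 ∩ (P_k^0)_d) ⊕ (P_k^+)_d/(A⁺P_k^+ ∩ (P_k^+)_d). -/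
open MvPolynomial

noncomputable section

abbrev homSub (k d : ℕ) : Submodule (ZMod 2) (P k) :=
  homogeneousSubmodule (Fin k) (ZMod 2) d
/-- The hit submodule `A⁺P_k = Σ_{n ≥ 1} Sq^n(P_k)`. -/
def hit (k : ℕ) : Submodule (ZMod 2) (P k) :=
  Submodule.span (ZMod 2) {f : P k | ∃ n : ℕ, 1 ≤ n ∧ ∃ g : P k, f = Sq k n g}

/-- `(QP_k)_d = (P_k)_d / (A⁺P_k ∩ (P_k)_d)`. -/
abbrev QP (k d : ℕ) :=
  ↥(homSub k d) ⧸ (hit k).comap (homSub k d).subtype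

/-- `P_k^0`: the span of the monomials having at least one zero exponent. -/
def PZero (k : ℕ) : Submodule (ZMod 2) (P k) :=
  Submodule.span (ZMod 2)
    {p : P k | ∃ s : Fin k →₀ ℕ, (∃ j, s j = 0) ∧ p = monomial s 1}

/-- `P_k^+`: the span of the monomials all of whose exponents are strictly positive. -/
def PPlus (k : ℕ) : Submodule (ZMod 2) (P k) :=
  Submodule.span (ZMod 2)
    {p : P k | ∃ s : Fin k →₀ ℕ, (∀ j, 0 < s j) ∧ p = monomial s 1}

/-- `A⁺P_k^0 = Σ_{n ≥ 1} Sq^n(P_k^0)`. -/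
def hitZero (k : ℕ) : Submodule (ZMod 2) (P k) :=
  Submodule.span (ZMod 2) {f : P k | ∃ n : ℕ, 1 ≤ n ∧ ∃ g ∈ PZero k, f = Sq k n g}

/-- `A⁺P_k^+ = Σ_{n ≥ 1} Sq^n(P_k^+)`. -/
def hitPlus (k : ℕ) : Submodule (ZMod 2) (P k) :=
  Submodule.span (ZMod 2) {f : P k | ∃ n : ℕ, 1 ≤ n ∧ ∃ g ∈ PPlus k, f = Sq k n g}

lemma hitZero_le_hit (k : ℕ) : hitZero k ≤ hit k := by
  apply Submodule.span_mono
  rintro f ⟨n, hn, g, _, rfl⟩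
  exact ⟨n, hn, g, rfl⟩

lemma hitPlus_le_hit (k : ℕ) : hitPlus k ≤ hit k := by
  apply Submodule.span_mono
  rintro f ⟨n, hn, g, _, rfl⟩
  exact ⟨n, hn, g, rfl⟩

/-- `(P_k^0)_d / (A⁺P_k^0 ∩ (P_k^0)_d)`. -/
abbrev Qloc0 (k d : ℕ) :=
  ↥(PZero k ⊓ homSub k d) ⧸ (hitZero k).comap (PZero k ⊓ homSub k d).subtype

/-- `(P_k^+)_d / (A⁺P_k^+ ∩ (P_k^+)_d)`. -/
abbrev QlocP (k d : ℕ) :=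
  ↥(PPlus k ⊓ homSub k d) ⧸ (hitPlus k).comap (PPlus k ⊓ homSub k d).subtype

/-- The map `(P_k^0)_d → (QP_k)_d` induced by the inclusion `P_k^0 ↪ P_k`. -/
def toQP0 (k d : ℕ) : ↥(PZero k ⊓ homSub k d) →ₗ[ZMod 2] QP k d :=
  ((hit k).comap (homSub k d).subtype).mkQ ∘ₗ Submodule.inclusion inf_le_right

/-- The map `(P_k^+)_d → (QP_k)_d` induced by the inclusion `P_k^+ ↪ P_k`. -/
def toQPP (k d : ℕ) : ↥(PPlus k ⊓ homSub k d) →ₗ[ZMod 2] QP k d :=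
  ((hit k).comap (homSub k d).subtype).mkQ ∘ₗ Submodule.inclusion inf_le_right

lemma toQP0_ker (k d : ℕ) :
    (hitZero k).comap (PZero k ⊓ homSub k d).subtype ≤ LinearMap.ker (toQP0 k d) := by
  intro x hx
  have hx' : (x : P k) ∈ hit k := hitZero_le_hit k hx
  have h : toQP0 k d x =
      Submodule.Quotient.mk (Submodule.inclusion inf_le_right x) := rfl
  rw [LinearMap.mem_ker, h, Submodule.Quotient.mk_eq_zero]
  exact hx'

lemma toQPP_ker (k d : ℕ) :
    (hitPlus k).comap (PPlus k ⊓ homSub k d).subtype ≤ LinearMap.ker (toQPP k d) := by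
  intro x hx
  have hx' : (x : P k) ∈ hit k := hitPlus_le_hit k hx
  have h : toQPP k d x =
      Submodule.Quotient.mk (Submodule.inclusion inf_le_right x) := rfl
  rw [LinearMap.mem_ker, h, Submodule.Quotient.mk_eq_zero]
  exact hx'

/-- The map `(P_k^0)_d/(A⁺P_k^0 ∩ (P_k^0)_d) → (QP_k)_d` induced by the inclusion. -/
def phi0 (k d : ℕ) : Qloc0 k d →ₗ[ZMod 2] QP k d :=
  Submodule.liftQ _ (toQP0 k d) (toQP0_ker k d)

/-- The map `(P_k^+)_d/(A⁺P_k^+ ∩ (P_k^+)_d) → (QP_k)_d` induced by the inclusion. -/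
def phiP (k d : ℕ) : QlocP k d →ₗ[ZMod 2] QP k d :=
  Submodule.liftQ _ (toQPP k d) (toQPP_ker k d)

lemma PZero_eq_restrictSupport (k : ℕ) :
    PZero k = restrictSupport (ZMod 2) {s : Fin k →₀ ℕ | ∃ j, s j = 0} := by
  rw [restrictSupport_eq_span, PZero]
  congr 1
  ext p
  simp only [Set.mem_image, Set.mem_ofPred_eq, eq_comm (a := p)]

lemma PPlus_eq_restrictSupport (k : ℕ) :
    PPlus k = restrictSupport (ZMod 2) {s : Fin k →₀ ℕ | ∀ j, 0 < s j} := by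
  rw [restrictSupport_eq_span, PPlus]
  congr 1
  ext p
  simp only [Set.mem_image, Set.mem_ofPred_eq, eq_comm (a := p)]

lemma mem_PZero_iff {k : ℕ} {f : P k} :
    f ∈ PZero k ↔ ∀ s ∈ f.support, ∃ j, s j = 0 := by
  rw [PZero_eq_restrictSupport]
  rfl

lemma mem_PPlus_iff {k : ℕ} {f : P k} :
    f ∈ PPlus k ↔ ∀ s ∈ f.support, ∀ j, 0 < s j := by
  rw [PPlus_eq_restrictSupport]
  rfl

lemma isCompl_PZero_PPlus (k : ℕ) : IsCompl (PZero k) (PPlus k) := by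
  constructor
  · rw [Submodule.disjoint_def]
    intro f h0 hp
    rw [mem_PZero_iff] at h0
    rw [mem_PPlus_iff] at hp
    rw [← support_eq_empty, Finset.eq_empty_iff_forall_notMem]
    intro s hs
    obtain ⟨j, hj⟩ := h0 s hs
    exact (hp s hs j).ne' hj
  · rw [codisjoint_iff, eq_top_iff]
    intro f _
    rw [f.as_sum]
    refine Submodule.sum_mem _ fun s _ => ?_
    rw [← mul_one (coeff s f), ← smul_eq_mul, ← smul_monomial]
    refine Submodule.smul_mem _ _ ?_
    by_cases h : ∃ j, s j = 0
    · exact Submodule.mem_sup_left (Submodule.subset_span ⟨s, h, rfl⟩)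
    · exact Submodule.mem_sup_right (Submodule.subset_span
        ⟨s, fun j => Nat.pos_of_ne_zero fun hj => h ⟨j, hj⟩, rfl⟩)

lemma support_homogeneousComponent_subset {k : ℕ} (n : ℕ) (f : P k) :
    (homogeneousComponent n f).support ⊆ f.support := by
  intro s hs
  rw [mem_support_iff, coeff_homogeneousComponent] at hs
  rw [mem_support_iff]
  exact fun h => hs (by simp [h])

lemma homogeneousComponent_mem_PZero {k : ℕ} (n : ℕ) {f : P k} (hf : f ∈ PZero k) :
    homogeneousComponent n f ∈ PZero k :=
  mem_PZero_iff.2 fun s hs =>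
    mem_PZero_iff.1 hf s (support_homogeneousComponent_subset n f hs)

lemma homogeneousComponent_mem_PPlus {k : ℕ} (n : ℕ) {f : P k} (hf : f ∈ PPlus k) :
    homogeneousComponent n f ∈ PPlus k :=
  mem_PPlus_iff.2 fun s hs =>
    mem_PPlus_iff.1 hf s (support_homogeneousComponent_subset n f hs)

lemma SqTotal_monomial {k : ℕ} (s : Fin k →₀ ℕ) :
    SqTotal k (monomial s 1) = ∏ i, (X i + X i ^ 2) ^ s i := by
  rw [SqTotal, aeval_monomial, map_one, one_mul, Finsupp.prod_fintype _ _ (by simp)]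

lemma SqTotal_mem_PZero {k : ℕ} {f : P k} (hf : f ∈ PZero k) : SqTotal k f ∈ PZero k := by
  induction hf using Submodule.span_induction with
  | mem x hx =>
    obtain ⟨s, ⟨j, hj⟩, rfl⟩ := hx
    have hmem : SqTotal k (monomial s 1) ∈ supported (ZMod 2) ({j}ᶜ : Set (Fin k)) := by
      rw [SqTotal_monomial]
      refine Subalgebra.prod_mem _ fun i _ => ?_
      by_cases hij : i = j
      · subst hij
        rw [hj, pow_zero]
        exact one_mem _
      · have hX : (X i : P k) ∈ supported (ZMod 2) ({j}ᶜ : Set (Fin k)) :=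
          X_mem_supported.2 hij
        exact pow_mem (add_mem hX (pow_mem hX 2)) _
    rw [mem_PZero_iff]
    refine fun t ht => ⟨j, mem_support_notMem_vars_zero ht fun hv => ?_⟩
    exact mem_supported.1 hmem hv rfl
  | zero => simp
  | add x y _ _ hx hy => rw [map_add]; exact add_mem hx hy
  | smul a x _ hx => rw [map_smul]; exact Submodule.smul_mem _ _ hx

lemma SqTotal_mem_PPlus {k : ℕ} {f : P k} (hf : f ∈ PPlus k) : SqTotal k f ∈ PPlus k := by
  induction hf using Submodule.span_induction with
  | mem x hx =>
    obtain ⟨s, hs, rfl⟩ := hx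
    have hfac : SqTotal k (monomial s 1) = monomial s 1 * ∏ i, (1 + X i) ^ s i := by
      rw [SqTotal_monomial, monomial_eq, map_one, one_mul, Finsupp.prod_fintype _ _ (by simp),
        ← Finset.prod_mul_distrib]
      refine Finset.prod_congr rfl fun i _ => ?_
      rw [← mul_pow]
      ring
    rw [hfac, mem_PPlus_iff]
    intro t ht j
    rw [mem_support_iff, coeff_monomial_mul'] at ht
    have hle : s ≤ t := by
      by_contra h
      exact ht (if_neg h)
    exact (hs j).trans_le (hle j)
  | zero => simp
  | add x y _ _ hx hy => rw [map_add]; exact add_mem hx hy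
  | smul a x _ hx => rw [map_smul]; exact Submodule.smul_mem _ _ hx

lemma Sq_mem_PZero {k : ℕ} (n : ℕ) {f : P k} (hf : f ∈ PZero k) : Sq k n f ∈ PZero k :=
  Submodule.sum_mem _ fun d _ => homogeneousComponent_mem_PZero _
    (SqTotal_mem_PZero (homogeneousComponent_mem_PZero d hf))

lemma Sq_mem_PPlus {k : ℕ} (n : ℕ) {f : P k} (hf : f ∈ PPlus k) : Sq k n f ∈ PPlus k :=
  Submodule.sum_mem _ fun d _ => homogeneousComponent_mem_PPlus _
    (SqTotal_mem_PPlus (homogeneousComponent_mem_PPlus d hf))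

lemma hitZero_le_PZero (k : ℕ) : hitZero k ≤ PZero k := by
  refine Submodule.span_le.2 ?_
  rintro _ ⟨n, _, g, hg, rfl⟩
  exact Sq_mem_PZero n hg

lemma hitPlus_le_PPlus (k : ℕ) : hitPlus k ≤ PPlus k := by
  refine Submodule.span_le.2 ?_
  rintro _ ⟨n, _, g, hg, rfl⟩
  exact Sq_mem_PPlus n hg

lemma Sq_eq_sum_range {k : ℕ} (n : ℕ) {f : P k} {N : ℕ} (hN : f.totalDegree + 1 ≤ N) :
    Sq k n f = ∑ d ∈ Finset.range N,
      homogeneousComponent (d + n) (SqTotal k (homogeneousComponent d f)) := by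
  refine Finset.sum_subset (Finset.range_mono hN) fun d _ hd => ?_
  have hd' : f.totalDegree < d := by simpa using hd
  rw [homogeneousComponent_eq_zero d f hd', map_zero, map_zero]

lemma Sq_add {k : ℕ} (n : ℕ) (f g : P k) : Sq k n (f + g) = Sq k n f + Sq k n g := by
  have hfg := totalDegree_add f g
  have hf := le_max_left f.totalDegree g.totalDegree
  have hg := le_max_right f.totalDegree g.totalDegree
  rw [Sq_eq_sum_range n (Nat.succ_le_succ hfg), Sq_eq_sum_range n (Nat.succ_le_succ hf),
    Sq_eq_sum_range n (Nat.succ_le_succ hg), ← Finset.sum_add_distrib]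
  simp only [map_add]

lemma hit_eq_sup (k : ℕ) : hit k = hitZero k ⊔ hitPlus k := by
  refine le_antisymm (Submodule.span_le.2 ?_) (sup_le (hitZero_le_hit k) (hitPlus_le_hit k))
  rintro _ ⟨n, hn, g, rfl⟩
  have hg : g ∈ PZero k ⊔ PPlus k := by
    rw [(isCompl_PZero_PPlus k).sup_eq_top]
    trivial
  obtain ⟨a, ha, b, hb, rfl⟩ := Submodule.mem_sup.1 hg
  rw [Sq_add]
  exact Submodule.add_mem_sup (Submodule.subset_span ⟨n, hn, a, ha, rfl⟩)
    (Submodule.subset_span ⟨n, hn, b, hb, rfl⟩)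

lemma mem_hitZero_and_mem_hitPlus_of_add_mem_hit {k : ℕ} {x y : P k} (hx : x ∈ PZero k)
    (hy : y ∈ PPlus k) (h : x + y ∈ hit k) : x ∈ hitZero k ∧ y ∈ hitPlus k := by
  rw [hit_eq_sup] at h
  obtain ⟨a, ha, b, hb, hab⟩ := Submodule.mem_sup.1 h
  have hsub : x - a = b - y := by
    rw [sub_eq_sub_iff_add_eq_add, ← hab, add_comm]
  have hzero : x - a = 0 := Submodule.disjoint_def.1 (isCompl_PZero_PPlus k).disjoint _
    (sub_mem hx (hitZero_le_PZero k ha)) (hsub ▸ sub_mem (hitPlus_le_PPlus k hb) hy)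
  have hxa : x = a := sub_eq_zero.1 hzero
  have hby : b = y := sub_eq_zero.1 (hsub.symm.trans hzero)
  exact ⟨hxa ▸ ha, hby ▸ hb⟩

lemma exists_add_eq_of_mem_homSub {k d : ℕ} {f : P k} (hf : f ∈ homSub k d) :
    ∃ a ∈ PZero k ⊓ homSub k d, ∃ b ∈ PPlus k ⊓ homSub k d, a + b = f := by
  have hmem : f ∈ PZero k ⊔ PPlus k := by
    rw [(isCompl_PZero_PPlus k).sup_eq_top]
    trivial
  obtain ⟨a, ha, b, hb, hab⟩ := Submodule.mem_sup.1 hmem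
  refine ⟨homogeneousComponent d a,
    ⟨homogeneousComponent_mem_PZero d ha, homogeneousComponent_mem d a⟩,
    homogeneousComponent d b,
    ⟨homogeneousComponent_mem_PPlus d hb, homogeneousComponent_mem d b⟩, ?_⟩
  rw [← map_add, hab, homogeneousComponent_of_mem hf, if_pos rfl]

/-- `A⁺P_k = A⁺P_k^0 ⊕ A⁺P_k^+`, and for each degree `d` the inclusions induce an
isomorphism `(QP_k)_d ≅ (P_k^0)_d/(A⁺P_k^0 ∩ (P_k^0)_d) ⊕ (P_k^+)_d/(A⁺P_k^+ ∩ (P_k^+)_d)`. -/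
theorem hit_direct_sum_decomposition (k : ℕ) (hk : 1 ≤ k) :
    hit k = hitZero k ⊔ hitPlus k ∧ Disjoint (hitZero k) (hitPlus k) ∧
      ∀ d : ℕ, Function.Bijective ((phi0 k d).coprod (phiP k d)) := by
  refine ⟨hit_eq_sup k, (isCompl_PZero_PPlus k).disjoint.mono (hitZero_le_PZero k)
    (hitPlus_le_PPlus k), fun d => ⟨?_, ?_⟩⟩
  · rw [← LinearMap.ker_eq_bot, LinearMap.ker_eq_bot']
    rintro ⟨u, v⟩ huv
    obtain ⟨x, rfl⟩ := Submodule.Quotient.mk_surjective _ u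
    obtain ⟨y, rfl⟩ := Submodule.Quotient.mk_surjective _ v
    have hmk : (Submodule.Quotient.mk (Submodule.inclusion inf_le_right x +
        Submodule.inclusion inf_le_right y) : QP k d) = 0 := huv
    rw [Submodule.Quotient.mk_eq_zero] at hmk
    obtain ⟨hx, hy⟩ := mem_hitZero_and_mem_hitPlus_of_add_mem_hit x.2.1 y.2.1 hmk
    exact Prod.ext ((Submodule.Quotient.mk_eq_zero _).2 hx)
      ((Submodule.Quotient.mk_eq_zero _).2 hy)
  · intro q
    obtain ⟨⟨f, hf⟩, rfl⟩ := Submodule.Quotient.mk_surjective _ q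
    obtain ⟨a, ha, b, hb, rfl⟩ := exists_add_eq_of_mem_homSub hf
    exact ⟨(Submodule.Quotient.mk ⟨a, ha⟩, Submodule.Quotient.mk ⟨b, hb⟩), rfl⟩
end
end

section
/- For every k ≥ 1 and every degree d ≥ 0, dim_{F₂} (QP_k)_d = Σ_ω dim_{F₂} QP_k(ω), where the sum ranges over all finitely supported sequences ω of nonnegative integers with deg ω = d. -/
open MvPolynomial

noncomputable section

/-- The weight vector of a monomial with exponent vector `s`:
`ω(x)_{j+1} = Σ_i α_j(s i)` (indices shifted so that position `j ≥ 0` carries `α_j`). -/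
def weightVec (k : ℕ) (s : Fin k →₀ ℕ) : ℕ →₀ ℕ :=
  ∑ j ∈ Finset.range ((∑ i, s i) + 1), Finsupp.single j (∑ i, (s i / 2 ^ j) % 2)

/-- The degree of a weight vector: `deg ω = Σ_j 2^j · ω_j` (with our 0-based indexing). -/
def degw (ω : ℕ →₀ ℕ) : ℕ := ω.sum fun j c => 2 ^ j * c

/-- Lexicographic strict order on finitely supported sequences (earlier indices more
significant). -/
def lexLT (ω₁ ω₂ : ℕ →₀ ℕ) : Prop :=
  ∃ j : ℕ, (∀ i < j, ω₁ i = ω₂ i) ∧ ω₁ j < ω₂ j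

/-- Lexicographic order on finitely supported sequences. -/
def lexLE (ω₁ ω₂ : ℕ →₀ ℕ) : Prop := ω₁ = ω₂ ∨ lexLT ω₁ ω₂

/-- `P_k(ω)`: the span of the degree-`d` monomials of weight at most `ω`. -/
def Pw (k d : ℕ) (ω : ℕ →₀ ℕ) : Submodule (ZMod 2) (P k) :=
  Submodule.span (ZMod 2)
    {p : P k | ∃ s : Fin k →₀ ℕ, (∑ i, s i) = d ∧ lexLE (weightVec k s) ω ∧ p = monomial s 1}

/-- `P_k^-(ω)`: the span of the degree-`d` monomials of weight strictly less than `ω`. -/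
def PwM (k d : ℕ) (ω : ℕ →₀ ℕ) : Submodule (ZMod 2) (P k) :=
  Submodule.span (ZMod 2)
    {p : P k | ∃ s : Fin k →₀ ℕ, (∑ i, s i) = d ∧ lexLT (weightVec k s) ω ∧ p = monomial s 1}

/-- `QP_k(ω) = P_k(ω) / ((A⁺P_k + P_k^-(ω)) ∩ P_k(ω))`. -/
abbrev QPw (k d : ℕ) (ω : ℕ →₀ ℕ) :=
  ↥(Pw k d ω) ⧸ (hit k ⊔ PwM k d ω).comap (Pw k d ω).subtype

/-- The subquotient `B / ((H + A) ∩ B)` has dimension the difference of the dimensions of the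
images of `B` and `A` modulo `H`. -/
theorem finrank_quotient_comap_sup_add {K M : Type*} [Field K] [AddCommGroup M] [Module K M]
    (H : Submodule K M) {A B : Submodule K M} (hAB : A ≤ B) [FiniteDimensional K B] :
    Module.finrank K (↥B ⧸ (H ⊔ A).comap B.subtype) + Module.finrank K (A.map H.mkQ) =
      Module.finrank K (B.map H.mkQ) := by
  let g : M ⧸ H →ₗ[K] M ⧸ (H ⊔ A) := Submodule.factor le_sup_left
  have hg : g ∘ₗ H.mkQ = (H ⊔ A).mkQ := by ext; rfl
  have hker : LinearMap.ker g = A.map H.mkQ := by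
    rw [← Submodule.map_comap_eq_of_surjective H.mkQ_surjective (LinearMap.ker g),
      ← LinearMap.ker_comp, hg, Submodule.ker_mkQ, Submodule.map_sup, Submodule.mkQ_map_self,
      bot_sup_eq]
  have hker' : Module.finrank K (LinearMap.ker (g.domRestrict (B.map H.mkQ))) =
      Module.finrank K (A.map H.mkQ) := by
    rw [LinearMap.ker_domRestrict, hker]
    exact (Submodule.comapSubtypeEquivOfLe (Submodule.map_mono hAB)).finrank_eq
  have hrange : LinearMap.range (g.domRestrict (B.map H.mkQ)) =
      LinearMap.range ((H ⊔ A).mkQ ∘ₗ B.subtype) := by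
    rw [LinearMap.range_domRestrict, LinearMap.range_comp, Submodule.range_subtype,
      ← Submodule.map_comp, hg]
  have hquot : Module.finrank K (↥B ⧸ (H ⊔ A).comap B.subtype) =
      Module.finrank K (LinearMap.range (g.domRestrict (B.map H.mkQ))) := by
    rw [hrange, ← ((H ⊔ A).mkQ ∘ₗ B.subtype).quotKerEquivRange.finrank_eq, LinearMap.ker_comp,
      Submodule.ker_mkQ]
  rw [hquot, ← hker', LinearMap.finrank_range_add_finrank_ker]

theorem sum_two_pow_mul_div_mod_two (m n : ℕ) :
    ∑ j ∈ Finset.range n, 2 ^ j * (m / 2 ^ j % 2) = m % 2 ^ n := by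
  induction n with
  | zero => simp [Nat.mod_one]
  | succ n ih => rw [Finset.sum_range_succ, ih, Nat.mod_pow_succ]

theorem degw_single (j c : ℕ) : degw (Finsupp.single j c) = 2 ^ j * c :=
  Finsupp.sum_single_index (by simp)

theorem degw_sum {ι : Type*} (t : Finset ι) (f : ι → ℕ →₀ ℕ) :
    degw (∑ i ∈ t, f i) = ∑ i ∈ t, degw (f i) :=
  Finsupp.sum_finsetSum_index (by simp) (fun _ _ _ => mul_add _ _ _) |>.symm

/-- The degree of the weight vector of a monomial is the degree of the monomial. -/
theorem degw_weightVec (k : ℕ) (s : Fin k →₀ ℕ) : degw (weightVec k s) = ∑ i, s i := by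
  rw [weightVec, degw_sum]
  simp_rw [degw_single, Finset.mul_sum]
  rw [Finset.sum_comm]
  refine Finset.sum_congr rfl fun i _ => ?_
  rw [sum_two_pow_mul_div_mod_two]
  refine Nat.mod_eq_of_lt ?_
  have hi : s i ≤ ∑ i, s i := Finset.single_le_sum (fun _ _ => Nat.zero_le _) (Finset.mem_univ i)
  have := Nat.lt_two_pow_self (n := (∑ i, s i) + 1)
  omega

theorem finite_setOf_degw_eq (d : ℕ) : {ω : ℕ →₀ ℕ | degw ω = d}.Finite := by
  refine (Set.finite_Icc (0 : ℕ →₀ ℕ) (∑ j ∈ Finset.range (d + 1), Finsupp.single j d)).subset ?_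
  rintro ω rfl
  refine ⟨zero_le, fun j => ?_⟩
  by_cases hj : ω j = 0
  · simp [hj]
  have hle : 2 ^ j * ω j ≤ degw ω :=
    Finset.single_le_sum (f := fun j => 2 ^ j * ω j) (fun _ _ => Nat.zero_le _)
      (Finsupp.mem_support_iff.2 hj)
  have hωj : ω j ≤ degw ω := (Nat.le_mul_of_pos_left _ (by positivity)).trans hle
  have hjd : j < degw ω + 1 := by
    have h1 : 2 ^ j ≤ 2 ^ j * ω j := Nat.le_mul_of_pos_right _ (Nat.pos_of_ne_zero hj)
    have := Nat.lt_two_pow_self (n := j)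
    omega
  simpa [Finsupp.finsetSum_apply, Finsupp.single_apply, hjd] using hωj

theorem lexLT_iff (ω₁ ω₂ : ℕ →₀ ℕ) : lexLT ω₁ ω₂ ↔ toLex ω₁ < toLex ω₂ :=
  Finsupp.Lex.lt_iff.symm

theorem lexLE_iff (ω₁ ω₂ : ℕ →₀ ℕ) : lexLE ω₁ ω₂ ↔ toLex ω₁ ≤ toLex ω₂ := by
  rw [le_iff_eq_or_lt, lexLE, lexLT_iff, toLex_inj]

/-- The span of the degree-`d` monomials whose weight vector lies in `S`. -/
def weightSpan (k d : ℕ) (S : Set (Lex (ℕ →₀ ℕ))) : Submodule (ZMod 2) (P k) :=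
  Submodule.span (ZMod 2)
    {p : P k | ∃ s : Fin k →₀ ℕ, (∑ i, s i) = d ∧ toLex (weightVec k s) ∈ S ∧ p = monomial s 1}

theorem weightSpan_Iic (k d : ℕ) (ω : ℕ →₀ ℕ) : weightSpan k d (Set.Iic (toLex ω)) = Pw k d ω := by
  simp only [weightSpan, Pw, lexLE_iff, Set.mem_Iic]

theorem weightSpan_Iio (k d : ℕ) (ω : ℕ →₀ ℕ) :
    weightSpan k d (Set.Iio (toLex ω)) = PwM k d ω := by
  simp only [weightSpan, PwM, lexLT_iff, Set.mem_Iio]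

theorem weightSpan_mono (k d : ℕ) {S T : Set (Lex (ℕ →₀ ℕ))} (h : S ⊆ T) :
    weightSpan k d S ≤ weightSpan k d T :=
  Submodule.span_mono fun _ ⟨s, hs, hS, hp⟩ => ⟨s, hs, h hS, hp⟩

/-- Only the weight vectors of degree `d` matter in `weightSpan`. -/
theorem weightSpan_congr (k d : ℕ) {S T : Set (Lex (ℕ →₀ ℕ))}
    (h : ∀ ω, degw ω = d → (toLex ω ∈ S ↔ toLex ω ∈ T)) : weightSpan k d S = weightSpan k d T := by
  unfold weightSpan
  congr 1
  ext p
  refine exists_congr fun s => and_congr_right fun hs => ?_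
  rw [h _ ((degw_weightVec k s).trans hs)]

theorem weightSpan_empty (k d : ℕ) : weightSpan k d ∅ = ⊥ := by
  simp [weightSpan]

theorem weightSpan_univ (k d : ℕ) : weightSpan k d Set.univ = homSub k d := by
  apply le_antisymm
  · refine Submodule.span_le.2 ?_
    rintro _ ⟨s, hs, -, rfl⟩
    exact isHomogeneous_monomial 1 (by rw [Finsupp.degree_eq_sum, hs])
  · intro p hp
    rw [p.as_sum]
    refine Submodule.sum_mem _ fun s hs => ?_
    rw [← mul_one (coeff s p), ← smul_eq_mul, ← smul_monomial]
    refine Submodule.smul_mem _ _ (Submodule.subset_span ⟨s, ?_, trivial, rfl⟩)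
    rw [← Finsupp.degree_eq_sum]
    by_contra h
    exact mem_support_iff.1 hs (((mem_homogeneousSubmodule _ _).1 hp).coeff_eq_zero h)

instance finiteDimensional_weightSpan (k d : ℕ) (S : Set (Lex (ℕ →₀ ℕ))) :
    FiniteDimensional (ZMod 2) (weightSpan k d S) := by
  refine FiniteDimensional.span_of_finite _
    (((Finset.finsuppAntidiag (Finset.univ : Finset (Fin k)) d).finite_toSet.image
      (fun s => (monomial s 1 : P k))).subset ?_)
  rintro _ ⟨s, hs, -, rfl⟩
  exact ⟨s, by simp [hs], rfl⟩

theorem finrank_QPw_add (k d : ℕ) (ω : ℕ →₀ ℕ) :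
    Module.finrank (ZMod 2) (QPw k d ω) +
        Module.finrank (ZMod 2) ((weightSpan k d (Set.Iio (toLex ω))).map (hit k).mkQ) =
      Module.finrank (ZMod 2) ((weightSpan k d (Set.Iic (toLex ω))).map (hit k).mkQ) := by
  have h := finrank_quotient_comap_sup_add (hit k)
    (weightSpan_mono k d (Set.Iio_subset_Iic_self (a := toLex ω)))
  rw [weightSpan_Iio, weightSpan_Iic] at h ⊢
  exact h

/-- Telescoping along a set of weight vectors that is closed downwards in degree `d`. -/
theorem finrank_map_weightSpan (k d : ℕ) (S : Finset (Lex (ℕ →₀ ℕ)))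
    (hS : ∀ a ∈ S, ∀ ω, degw ω = d → toLex ω < a → toLex ω ∈ S) :
    Module.finrank (ZMod 2) ((weightSpan k d S).map (hit k).mkQ) =
      ∑ a ∈ S, Module.finrank (ZMod 2) (QPw k d (ofLex a)) := by
  induction S using Finset.induction_on_max with
  | empty =>
    rw [Finset.coe_empty, weightSpan_empty, Submodule.map_bot, finrank_bot, Finset.sum_empty]
  | insert a S ha ih =>
    have hIio : weightSpan k d S = weightSpan k d (Set.Iio (toLex (ofLex a))) := by
      refine weightSpan_congr k d fun ω hω => ⟨fun h => ha _ h, fun h => ?_⟩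
      exact (Finset.mem_insert.1 (hS a (Finset.mem_insert_self a S) ω hω h)).resolve_left h.ne
    have hIic : weightSpan k d ↑(insert a S) = weightSpan k d (Set.Iic (toLex (ofLex a))) := by
      refine weightSpan_congr k d fun ω hω => ⟨fun h => ?_, fun h => ?_⟩
      · rcases Finset.mem_insert.1 h with h | h
        · exact h.le
        · exact (ha _ h).le
      · rcases (show toLex ω ≤ a from h).eq_or_lt with h | h
        · exact Finset.mem_insert.2 (Or.inl h)
        · exact hS a (Finset.mem_insert_self a S) ω hω h
    rw [Finset.sum_insert fun h => (ha a h).false, ← ih, hIic, hIio, finrank_QPw_add]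
    intro b hb ω hω hlt
    exact (Finset.mem_insert.1 (hS b (Finset.mem_insert_of_mem hb) ω hω hlt)).resolve_left
      (hlt.trans (ha b hb)).ne

theorem finrank_QP (k d : ℕ) :
    Module.finrank (ZMod 2) (QP k d) =
      Module.finrank (ZMod 2) ((weightSpan k d Set.univ).map (hit k).mkQ) := by
  have h := ((hit k).mkQ ∘ₗ (homSub k d).subtype).quotKerEquivRange.finrank_eq
  rw [LinearMap.ker_comp, Submodule.ker_mkQ, LinearMap.range_comp, Submodule.range_subtype] at h
  rw [weightSpan_univ, h]

/-- `dim (QP_k)_d = Σ_{deg ω = d} dim QP_k(ω)`. -/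
theorem dim_QP_eq_sum_weight (k d : ℕ) (hk : 1 ≤ k) :
    Module.finrank (ZMod 2) (QP k d) =
      ∑ᶠ (ω : ℕ →₀ ℕ) (_ : degw ω = d), Module.finrank (ZMod 2) (QPw k d ω) := by
  rw [finrank_QP]
  refine .trans ?_ (finsum_mem_eq_finite_toFinset_sum _ (finite_setOf_degw_eq d)).symm
  have h := finrank_map_weightSpan k d ((finite_setOf_degw_eq d).toFinset.map toLex.toEmbedding)
    fun a _ ω hω _ => by simpa using hω
  rw [Finset.sum_map] at h
  rw [weightSpan_congr k d (T := ((finite_setOf_degw_eq d).toFinset.map toLex.toEmbedding :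
    Finset (Lex (ℕ →₀ ℕ)))) fun ω hω => by simpa using hω]
  exact h
end
end

section
/- Let f ∈ (P_4)_{33} be the sum of the following 16 monomials: x_1x_2x_3x_4^{30}, x_1x_2x_3^3x_4^{28}, x_1x_2^3x_3x_4^{28}, x_1x_2^3x_3^4x_4^{25}, x_1x_2^7x_3^{11}x_4^{14}, x_1x_2^7x_3^{14}x_4^{11}, x_1^3x_2x_3x_4^{28}, x_1^3x_2x_3^4x_4^{25}, x_1^3x_2^5x_3x_4^{24}, x_1^3x_2^5x_3^{11}x_4^{14}, x_1^3x_2^5x_3^{14}x_4^{11}, x_1^7x_2x_3^{11}x_4^{14}, x_1^7x_2x_3^{14}x_4^{11}, x_1^7x_2^7x_3^{11}x_4^{8}, x_1^7x_2^7x_3^{8}x_4^{11}, x_1^7x_2^7x_3^{9}x_4^{10}. Then f ∉ A⁺P_4 and ρ_j(f) + f ∈ A⁺P_4 for every j ∈ {1, 2, 3, 4}; hence the class of f is a nonzero GL_4(F₂)-invariant element of (QP_4)_{33}. -/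
open MvPolynomial

noncomputable section

/-- The algebra endomorphism of `P k` given by the linear substitution `x_i ↦ Σ_j C_{ij} x_j`. -/
def psi (k : ℕ) (C : Matrix (Fin k) (Fin k) (ZMod 2)) : P k →ₐ[ZMod 2] P k :=
  aeval (fun i => ∑ j, C i j • X j)

/-- The generators `ρ_j` of `GL_k(F₂)` acting on `P k` (0-indexed: for `j + 1 < k` the
transposition of `x_{j+1}` and `x_{j+2}` in 1-indexed notation, i.e. of the variables with
indices `j` and `j+1`; for `j = k - 1` the transvection `x_k ↦ x_k + x_{k-1}`). -/
def rho (k : ℕ) (j : ℕ) : P k →ₐ[ZMod 2] P k :=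
  if h : j + 1 < k then
    aeval (fun i => X (Equiv.swap (⟨j, by omega⟩ : Fin k) (⟨j + 1, h⟩ : Fin k) i))
  else if h2 : 2 ≤ k then
    aeval (fun i : Fin k =>
      if i = (⟨k - 1, by omega⟩ : Fin k) then X i + X (⟨k - 2, by omega⟩ : Fin k)
      else X i)
  else
    aeval X
/-- The explicit degree-33 polynomial `f`, a sum of 16 monomials. -/
def f17 : P 4 :=
  X 0 * X 1 * X 2 * X 3 ^ 30 +
  X 0 * X 1 * X 2 ^ 3 * X 3 ^ 28 +
  X 0 * X 1 ^ 3 * X 2 * X 3 ^ 28 +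
  X 0 * X 1 ^ 3 * X 2 ^ 4 * X 3 ^ 25 +
  X 0 * X 1 ^ 7 * X 2 ^ 11 * X 3 ^ 14 +
  X 0 * X 1 ^ 7 * X 2 ^ 14 * X 3 ^ 11 +
  X 0 ^ 3 * X 1 * X 2 * X 3 ^ 28 +
  X 0 ^ 3 * X 1 * X 2 ^ 4 * X 3 ^ 25 +
  X 0 ^ 3 * X 1 ^ 5 * X 2 * X 3 ^ 24 +
  X 0 ^ 3 * X 1 ^ 5 * X 2 ^ 11 * X 3 ^ 14 +
  X 0 ^ 3 * X 1 ^ 5 * X 2 ^ 14 * X 3 ^ 11 +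
  X 0 ^ 7 * X 1 * X 2 ^ 11 * X 3 ^ 14 +
  X 0 ^ 7 * X 1 * X 2 ^ 14 * X 3 ^ 11 +
  X 0 ^ 7 * X 1 ^ 7 * X 2 ^ 11 * X 3 ^ 8 +
  X 0 ^ 7 * X 1 ^ 7 * X 2 ^ 8 * X 3 ^ 11 +
  X 0 ^ 7 * X 1 ^ 7 * X 2 ^ 9 * X 3 ^ 10

section HitInvariance

lemma sqTotal_X {k : ℕ} (i : Fin k) : SqTotal k (X i) = X i + X i ^ 2 := by
  simp [SqTotal]

lemma homogeneousComponent_sqTotal_mem_hit {k d n : ℕ} {g : P k} (hg : g.IsHomogeneous d)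
    (hn : 1 ≤ n) : homogeneousComponent (d + n) (SqTotal k g) ∈ hit k := by
  by_cases h0 : g = 0
  · simp [h0]
  refine Submodule.subset_span ⟨n, hn, g, ?_⟩
  rw [Sq, hg.totalDegree h0, Finset.sum_eq_single d]
  · rw [homogeneousComponent_of_mem hg, if_pos rfl]
  · intro e _ he
    rw [homogeneousComponent_of_mem hg, if_neg he, map_zero, map_zero]
  · simp

lemma isHomogeneous_algHom {k d : ℕ} {φ : P k →ₐ[ZMod 2] P k}
    (hφ : ∀ i, (φ (X i)).IsHomogeneous 1) {p : P k} (hp : p.IsHomogeneous d) :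
    (φ p).IsHomogeneous d := by
  rw [aeval_unique φ, ← one_mul d]
  exact hp.aeval _ hφ

lemma homogeneousComponent_algHom {k : ℕ} {φ : P k →ₐ[ZMod 2] P k}
    (hφ : ∀ i, (φ (X i)).IsHomogeneous 1) (d : ℕ) (p : P k) :
    homogeneousComponent d (φ p) = φ (homogeneousComponent d p) := by
  conv_lhs => rw [← sum_homogeneousComponent p, map_sum, map_sum]
  have h (e : ℕ) : homogeneousComponent d (φ (homogeneousComponent e p)) =
      if d = e then φ (homogeneousComponent e p) else 0 :=
    homogeneousComponent_of_mem (isHomogeneous_algHom hφ (homogeneousComponent_isHomogeneous e p))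
  simp only [h, Finset.sum_ite_eq, Finset.mem_range]
  split_ifs with hd
  · rfl
  · rw [homogeneousComponent_eq_zero d p (by omega), map_zero]

lemma algHom_mem_hit {k : ℕ} {φ : P k →ₐ[ZMod 2] P k}
    (hφ : ∀ i, (φ (X i)).IsHomogeneous 1)
    (hSq : ∀ i, SqTotal k (φ (X i)) = φ (X i) + φ (X i) ^ 2) {p : P k} (hp : p ∈ hit k) :
    φ p ∈ hit k := by
  have hcomm : (SqTotal k).comp φ = φ.comp (SqTotal k) := by
    ext1 i
    simp [hSq, sqTotal_X]
  induction hp using Submodule.span_induction with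
  | zero => simp
  | add x y _ _ hx hy => rw [map_add]; exact add_mem hx hy
  | smul a x _ hx => rw [map_smul]; exact Submodule.smul_mem _ a hx
  | mem x hx =>
    obtain ⟨n, hn, g, rfl⟩ := hx
    rw [Sq, map_sum]
    refine sum_mem fun d _ => ?_
    rw [← homogeneousComponent_algHom hφ, ← AlgHom.comp_apply, ← hcomm, AlgHom.comp_apply]
    exact homogeneousComponent_sqTotal_mem_hit
      (isHomogeneous_algHom hφ (homogeneousComponent_isHomogeneous d g)) hn

/-- The algebra endomorphisms preserving the hit submodule and fixing `f` modulo hits. -/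
def hitStabilizer {k : ℕ} (f : P k) : Submonoid (P k →ₐ[ZMod 2] P k) where
  carrier := {φ | (∀ p ∈ hit k, φ p ∈ hit k) ∧ φ f + f ∈ hit k}
  one_mem' := by simp [CharTwo.add_self_eq_zero]
  mul_mem' := by
    rintro φ χ ⟨hφ, hφf⟩ ⟨hχ, hχf⟩
    refine ⟨fun p hp => hφ _ (hχ p hp), ?_⟩
    have h := add_mem (hφ _ hχf) hφf
    rwa [map_add, add_assoc, ← add_assoc (φ f), CharTwo.add_self_eq_zero, zero_add] at h

lemma psi_mul {k : ℕ} (A B : Matrix (Fin k) (Fin k) (ZMod 2)) :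
    psi k (A * B) = psi k B * psi k A := by
  ext1 i
  simp only [psi, aeval_X, AlgHom.mul_apply, map_sum, map_smul, Matrix.mul_apply,
    Finset.smul_sum, Finset.sum_smul, mul_smul]
  exact Finset.sum_comm

lemma psi_one (k : ℕ) : psi k 1 = 1 := by
  ext1 i
  simp [psi, Matrix.one_apply]

lemma rename_mem_hit {k : ℕ} (σ : Equiv.Perm (Fin k)) {p : P k} (hp : p ∈ hit k) :
    rename σ p ∈ hit k :=
  algHom_mem_hit (φ := rename σ) (by simp [isHomogeneous_X]) (by simp [sqTotal_X]) hp

lemma rho_swap (j : Fin 3) :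
    rho 4 j = rename (Equiv.swap (Fin.castSucc j) (Fin.succ j)) := by
  ext1 i
  simp only [rho, show (j : ℕ) + 1 < 4 by omega, dite_true, aeval_X, rename_X]
  rfl

lemma rho_three_X (i : Fin 4) : rho 4 3 (X i) = X i + if i = 3 then X 2 else 0 := by
  have h : rho 4 3 (X i) = if i = 3 then X i + X 2 else X i := by simp [rho]
  rw [h]
  split_ifs <;> simp

lemma rho_mem_hit {j : ℕ} (hj : j < 4) {p : P 4} (hp : p ∈ hit 4) : rho 4 j p ∈ hit 4 := by
  rcases Nat.lt_succ_iff_lt_or_eq.1 hj with h | rfl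
  · rw [show j = ((⟨j, h⟩ : Fin 3) : ℕ) from rfl, rho_swap]
    exact rename_mem_hit _ hp
  · refine algHom_mem_hit (fun i => ?_) (fun i => ?_) hp
    · rw [rho_three_X]
      split_ifs
      · exact (isHomogeneous_X _ _).add (isHomogeneous_X _ _)
      · simpa using isHomogeneous_X _ _
    · rw [rho_three_X]
      split_ifs
      · simp only [map_add, sqTotal_X, CharTwo.add_sq]
        ring
      · simp [sqTotal_X]

lemma rename_mem_hitStabilizer {f : P 4} (hf : ∀ j < 4, rho 4 j ∈ hitStabilizer f)
    (σ : Equiv.Perm (Fin 4)) : (rename σ : P 4 →ₐ[ZMod 2] P 4) ∈ hitStabilizer f := by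
  have hσ : σ ∈ Submonoid.closure
      (Set.range fun i : Fin 3 => Equiv.swap (Fin.castSucc i) (Fin.succ i)) := by
    simp [Equiv.Perm.mclosure_swap_castSucc_succ]
  induction hσ using Submonoid.closure_induction with
  | mem x hx =>
    obtain ⟨j, rfl⟩ := hx
    rw [← rho_swap]
    exact hf j (by omega)
  | one =>
    convert one_mem (hitStabilizer f)
    ext1 i
    simp
  | mul x y _ _ hx hy =>
    convert mul_mem hx hy
    ext1 i
    simp

lemma psi_transvection (σ : Equiv.Perm (Fin 4)) :
    psi 4 (Matrix.transvection (σ 3) (σ 2) 1) = rename σ * rho 4 3 * rename σ.symm := by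
  ext1 l
  have h : σ.symm l = 3 ↔ σ 3 = l := by rw [Equiv.symm_apply_eq, eq_comm]
  simp only [psi, Matrix.transvection, aeval_X, Matrix.add_apply, Matrix.one_apply,
    Matrix.single_apply, add_smul, ite_smul, one_smul, zero_smul, Finset.sum_add_distrib,
    AlgHom.mul_apply, rename_X, rho_three_X, map_add, Equiv.apply_symm_apply, h]
  by_cases hl : σ 3 = l <;> simp [hl]

lemma psi_mem_hitStabilizer {f : P 4} (hf : ∀ j < 4, rho 4 j ∈ hitStabilizer f)
    {M : Matrix (Fin 4) (Fin 4) (ZMod 2)} (hM : M.det ≠ 0) : psi 4 M ∈ hitStabilizer f := by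
  refine Matrix.diagonal_transvection_induction_of_det_ne_zero
    (fun M => psi 4 M ∈ hitStabilizer f) M hM (fun D hD => ?_) (fun t => ?_)
    (fun A B _ _ hA hB => ?_)
  · have h2 : ∀ x : ZMod 2, x ≠ 0 → x = 1 := by decide
    have hD1 : D = 1 := by
      funext i
      rw [Matrix.det_diagonal, Finset.prod_ne_zero_iff] at hD
      exact h2 _ (hD i (Finset.mem_univ i))
    rw [hD1, Matrix.diagonal_one', psi_one]
    exact one_mem _
  · obtain ⟨i, j, hij, c⟩ := t
    have h2 : ∀ x : ZMod 2, x = 0 ∨ x = 1 := by decide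
    rcases h2 c with rfl | rfl
    · simp [Matrix.TransvectionStruct.toMatrix, psi_one]
    · have hσ : ∀ i j : Fin 4, i ≠ j → ∃ σ : Equiv.Perm (Fin 4), σ 3 = i ∧ σ 2 = j := by decide
      obtain ⟨σ, rfl, rfl⟩ := hσ i j hij
      rw [Matrix.TransvectionStruct.toMatrix, psi_transvection]
      exact mul_mem (mul_mem (rename_mem_hitStabilizer hf σ) (hf 3 (by norm_num)))
        (rename_mem_hitStabilizer hf σ.symm)
  · rw [psi_mul]
    exact mul_mem hB hA

end HitInvariance

section XorSum

/-- The bitwise exclusive or of a list of natural numbers. -/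
def xorSum (l : List ℕ) : ℕ :=
  l.foldr (fun a b => a ^^^ b) 0

variable {α M : Type*} [AddCommGroup M]

/-- The sum of `f (dec i)` over the positions `i < N` of the bits set in `n`. -/
def bitSum (dec : ℕ → α) (f : α → M) (N n : ℕ) : M :=
  ∑ i ∈ Finset.range N, if n.testBit i then f (dec i) else 0

lemma bitSum_xor [Module (ZMod 2) M] (dec : ℕ → α) (f : α → M) (N m n : ℕ) :
    bitSum dec f N (m ^^^ n) = bitSum dec f N m + bitSum dec f N n := by
  rw [bitSum, bitSum, bitSum, ← Finset.sum_add_distrib]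
  refine Finset.sum_congr rfl fun i _ => ?_
  rw [Nat.testBit_xor]
  cases m.testBit i <;> cases n.testBit i <;> simp [ZModModule.add_self]

lemma bitSum_xorSum [Module (ZMod 2) M] (dec : ℕ → α) (f : α → M) (N : ℕ) (l : List ℕ) :
    bitSum dec f N (xorSum l) = (l.map (bitSum dec f N)).sum := by
  induction l with
  | nil => simp [xorSum, bitSum]
  | cons a l ih => rw [List.map_cons, List.sum_cons, ← ih, ← bitSum_xor]; rfl

lemma bitSum_two_pow {dec : ℕ → α} (f : α → M) {N : ℕ} {code : α → ℕ} {s : α}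
    (hdec : dec (code s) = s) (hN : code s < N) : bitSum dec f N (2 ^ code s) = f s := by
  rw [bitSum, Finset.sum_eq_single (code s)]
  · simp [Nat.testBit_two_pow_self, hdec]
  · intro i _ hi
    simp [Nat.testBit_two_pow_of_ne hi.symm]
  · simp [hN]

/-- The set of codes occurring an odd number of times in a list, encoded in binary. -/
def parityMask (code : α → ℕ) (l : List α) : ℕ :=
  xorSum (l.map fun s => 2 ^ code s)

lemma bitSum_parityMask [Module (ZMod 2) M] {dec : ℕ → α} (f : α → M) {N : ℕ}
    {code : α → ℕ} {l : List α} (h : ∀ s ∈ l, dec (code s) = s ∧ code s < N) :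
    bitSum dec f N (parityMask code l) = (l.map f).sum := by
  rw [parityMask, bitSum_xorSum, List.map_map]
  congr 1
  exact List.map_congr_left fun s hs => bitSum_two_pow f (h s hs).1 (h s hs).2

/-- Two families of terms whose codes occur with the same parities have the same sum in
characteristic two. -/
lemma sum_map_eq_of_parityMask_eq [Module (ZMod 2) M] {β : Type*} {dec : ℕ → α}
    {code : α → ℕ} {N : ℕ} {c : List β} {T : β → List α} {l : List α} (f : α → M)
    (hT : ∀ b ∈ c, ∀ s ∈ T b, dec (code s) = s ∧ code s < N)
    (hl : ∀ s ∈ l, dec (code s) = s ∧ code s < N)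
    (h : xorSum (c.map fun b => parityMask code (T b)) = parityMask code l) :
    (c.map fun b => ((T b).map f).sum).sum = (l.map f).sum := by
  rw [← bitSum_parityMask f hl, ← h, bitSum_xorSum, List.map_map]
  congr 1
  exact List.map_congr_left fun b hb => (bitSum_parityMask f (hT b hb)).symm

end XorSum

section Monomials

lemma sum_map_flatMap {α β M : Type*} [AddCommMonoid M] (l : List α) (g : α → List β)
    (f : β → M) : ((l.flatMap g).map f).sum = (l.map fun a => ((g a).map f).sum).sum := by
  induction l with
  | nil => simp
  | cons a l ih => simp [ih]

lemma map_sum_map {α M N F : Type*} [AddCommMonoid M] [AddCommMonoid N] [FunLike F M N]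
    [AddMonoidHomClass F M N] (φ : F) (l : List α) (f : α → M) :
    φ (l.map f).sum = (l.map fun a => φ (f a)).sum := by
  rw [map_list_sum, List.map_map]
  rfl

/-- The positions of the odd binomial coefficients `a.choose b`, for `a < 2 ^ k`. -/
def oddChoose : ℕ → ℕ → List ℕ
  | 0, _ => [0]
  | k + 1, a =>
    if a % 2 = 0 then (oddChoose k (a / 2)).map fun b => 2 * b
    else (oddChoose k (a / 2)).flatMap fun b => [2 * b, 2 * b + 1]

lemma le_of_mem_oddChoose {k a b : ℕ} (h : b ∈ oddChoose k a) : b ≤ a := by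
  induction k generalizing a b with
  | zero => simp_all [oddChoose]
  | succ k ih =>
    rw [oddChoose] at h
    split_ifs at h with ha
    · obtain ⟨c, hc, rfl⟩ := List.mem_map.1 h
      have := ih hc
      omega
    · obtain ⟨c, hc, hb⟩ := List.mem_flatMap.1 h
      have := ih hc
      simp only [List.mem_cons, List.not_mem_nil, or_false] at hb
      omega

lemma add_pow_eq_sum_oddChoose {R : Type*} [CommRing R] [CharP R 2] {k a : ℕ} (ha : a < 2 ^ k)
    (x y : R) : (x + y) ^ a = ((oddChoose k a).map fun b => x ^ (a - b) * y ^ b).sum := by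
  induction k generalizing a x y with
  | zero => simp_all [oddChoose]
  | succ k ih =>
    have hsq := ih (a := a / 2) (by omega) (x ^ 2) (y ^ 2)
    rw [← CharTwo.add_sq, ← pow_mul] at hsq
    rw [oddChoose]
    split_ifs with h
    · obtain ⟨c, rfl⟩ : ∃ c, a = 2 * c := ⟨a / 2, by omega⟩
      rw [Nat.mul_div_cancel_left c two_pos] at hsq ⊢
      rw [hsq, List.map_map]
      congr 1
      refine List.map_congr_left fun b hb => ?_
      rw [Function.comp_apply, ← pow_mul, ← pow_mul, Nat.mul_sub]
    · have hp : (x + y) ^ a = (x + y) ^ (2 * (a / 2)) * (x + y) := by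
        rw [← pow_succ]; congr 1; omega
      rw [sum_map_flatMap, hp, hsq, ← List.sum_map_mul_right]
      congr 1
      refine List.map_congr_left fun b hb => ?_
      have hb := le_of_mem_oddChoose hb
      rw [show a = 2 * (a / 2 - b) + 2 * b + 1 by omega,
        show (2 * (a / 2 - b) + 2 * b + 1) / 2 = a / 2 - b + b by omega]
      simp only [List.map_cons, List.map_nil, List.sum_cons, List.sum_nil, ← pow_mul]
      rw [show 2 * (a / 2 - b) + 2 * b + 1 - 2 * b = 2 * (a / 2 - b) + 1 by omega,
        show 2 * (a / 2 - b) + 2 * b + 1 - (2 * b + 1) = 2 * (a / 2 - b) by omega,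
        Nat.add_sub_cancel]
      ring

/-- Exponents of monomials in four variables. -/
abbrev Exps := ℕ × ℕ × ℕ × ℕ

/-- The monomial with the given exponents. -/
def mon (t : Exps) : P 4 :=
  X 0 ^ t.1 * X 1 ^ t.2.1 * X 2 ^ t.2.2.1 * X 3 ^ t.2.2.2

/-- The total degree of a monomial. -/
def Exps.degree (t : Exps) : ℕ :=
  t.1 + t.2.1 + t.2.2.1 + t.2.2.2

/-- The exponents as a finitely supported function. -/
def Exps.toFinsupp (t : Exps) : Fin 4 →₀ ℕ :=
  Finsupp.equivFunOnFinite.symm ![t.1, t.2.1, t.2.2.1, t.2.2.2]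

lemma mon_eq_monomial (t : Exps) : mon t = monomial t.toFinsupp 1 := by
  rw [monomial_eq, Finsupp.prod_fintype _ _ (by simp)]
  simp [Fin.prod_univ_four, Exps.toFinsupp, mon]

lemma monomial_eq_mon (m : Fin 4 →₀ ℕ) : monomial m 1 = mon (m 0, m 1, m 2, m 3) := by
  rw [mon_eq_monomial]
  congr 2
  ext i
  fin_cases i <;> rfl

lemma toFinsupp_injective : Function.Injective Exps.toFinsupp := by
  intro s t h
  have h' (i : Fin 4) := DFunLike.congr_fun h i
  exact Prod.ext (h' 0) (Prod.ext (h' 1) (Prod.ext (h' 2) (h' 3)))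

lemma coeff_mon (s t : Exps) :
    coeff s.toFinsupp (mon t) = if t = s then (1 : ZMod 2) else 0 := by
  rw [mon_eq_monomial, coeff_monomial]
  simp [toFinsupp_injective.eq_iff]

lemma isHomogeneous_mon (t : Exps) : (mon t).IsHomogeneous t.degree := by
  have h (i : Fin 4) (n : ℕ) : (X i ^ n : P 4).IsHomogeneous n := by
    simpa using (isHomogeneous_X (ZMod 2) i).pow n
  exact (((h 0 _).mul (h 1 _)).mul (h 2 _)).mul (h 3 _)

lemma sqTotal_X_pow {k a : ℕ} (ha : a < 2 ^ k) (i : Fin 4) :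
    SqTotal 4 (X i ^ a) = ((oddChoose k a).map fun b => X i ^ (a + b)).sum := by
  rw [map_pow, sqTotal_X, add_pow_eq_sum_oddChoose ha]
  congr 1
  refine List.map_congr_left fun b hb => ?_
  have := le_of_mem_oddChoose hb
  rw [← pow_mul, ← pow_add]
  congr 1
  omega

lemma sqTotal_mon {k : ℕ} {t : Exps} (ht : t.degree < 2 ^ k) :
    SqTotal 4 (mon t) =
      ((oddChoose k t.1).map fun b₀ => ((oddChoose k t.2.1).map fun b₁ =>
        ((oddChoose k t.2.2.1).map fun b₂ => ((oddChoose k t.2.2.2).map fun b₃ =>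
          mon (t.1 + b₀, t.2.1 + b₁, t.2.2.1 + b₂, t.2.2.2 + b₃)).sum).sum).sum).sum := by
  rw [Exps.degree] at ht
  simp only [mon, map_mul]
  rw [sqTotal_X_pow (show t.1 < 2 ^ k by omega), sqTotal_X_pow (show t.2.1 < 2 ^ k by omega),
    sqTotal_X_pow (show t.2.2.1 < 2 ^ k by omega), sqTotal_X_pow (show t.2.2.2 < 2 ^ k by omega)]
  simp only [List.sum_map_mul_left, List.sum_map_mul_right]

end Monomials

section Hit

/-- The exponents of the monomials occurring in `Sq^n` of a monomial, by the Cartan formula. -/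
def sqTerms (n : ℕ) (t : Exps) : List Exps :=
  (oddChoose 6 t.1).flatMap fun b₀ => if n < b₀ then [] else
    (oddChoose 6 t.2.1).flatMap fun b₁ => if n < b₀ + b₁ then [] else
      (oddChoose 6 t.2.2.1).flatMap fun b₂ => if n < b₀ + b₁ + b₂ then [] else
        (oddChoose 6 t.2.2.2).flatMap fun b₃ => if b₀ + b₁ + b₂ + b₃ = n then
          [(t.1 + b₀, t.2.1 + b₁, t.2.2.1 + b₂, t.2.2.2 + b₃)] else []

lemma degree_of_mem_sqTerms {n : ℕ} {s t : Exps} (h : s ∈ sqTerms n t) :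
    s.degree = t.degree + n := by
  simp only [sqTerms, List.mem_flatMap, List.mem_ite_nil_left, List.mem_ite_nil_right,
    List.mem_singleton] at h
  obtain ⟨b₀, -, -, b₁, -, -, b₂, -, -, b₃, -, hb, rfl⟩ := h
  simp only [Exps.degree]
  omega

lemma homogeneousComponent_sqTotal_mon {n : ℕ} {t : Exps} (ht : t.degree < 64) :
    homogeneousComponent (t.degree + n) (SqTotal 4 (mon t)) = ((sqTerms n t).map mon).sum := by
  have hc (b₀ b₁ b₂ b₃ : ℕ) : homogeneousComponent (t.degree + n)
      (mon (t.1 + b₀, t.2.1 + b₁, t.2.2.1 + b₂, t.2.2.2 + b₃)) = if b₀ + b₁ + b₂ + b₃ = n then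
        mon (t.1 + b₀, t.2.1 + b₁, t.2.2.1 + b₂, t.2.2.2 + b₃) else 0 := by
    rw [homogeneousComponent_of_mem (isHomogeneous_mon _)]
    refine if_congr ?_ rfl rfl
    simp only [Exps.degree]
    omega
  rw [sqTotal_mon (k := 6) ht, sqTerms]
  simp only [map_sum_map, hc, sum_map_flatMap]
  congr 1
  refine List.map_congr_left fun b₀ _ => ?_
  split_ifs with h₀
  · simp [show ∀ x y z, b₀ + x + y + z ≠ n by omega]
  rw [sum_map_flatMap]
  congr 1
  refine List.map_congr_left fun b₁ _ => ?_
  split_ifs with h₁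
  · simp [show ∀ y z, b₀ + b₁ + y + z ≠ n by omega]
  rw [sum_map_flatMap]
  congr 1
  refine List.map_congr_left fun b₂ _ => ?_
  split_ifs with h₂
  · simp [show ∀ z, b₀ + b₁ + b₂ + z ≠ n by omega]
  rw [sum_map_flatMap]
  congr 1
  refine List.map_congr_left fun b₃ _ => ?_
  split_ifs <;> simp

/-- A numbering of the monomials of degree `33`. -/
def code33 (t : Exps) : ℕ :=
  t.1 + 34 * (t.2.1 + 34 * t.2.2.1)

/-- The inverse of `code33`. -/
def decode33 (n : ℕ) : Exps :=
  (n % 34, n / 34 % 34, n / 34 / 34, 33 - (n % 34 + n / 34 % 34 + n / 34 / 34))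

lemma decode33_code33 {t : Exps} (ht : t.degree = 33) :
    decode33 (code33 t) = t ∧ code33 t < 39304 := by
  obtain ⟨a, b, c, d⟩ := t
  simp only [Exps.degree, decode33, code33, Prod.mk.injEq] at *
  omega

lemma sum_mon_mem_hit (c : List Exps) {l : List Exps} (hl : ∀ s ∈ l, s.degree = 33)
    (hc : ∀ t ∈ c, t.degree < 33)
    (h : xorSum (c.map fun t => parityMask code33 (sqTerms (33 - t.degree) t)) =
      parityMask code33 l) : (l.map mon).sum ∈ hit 4 := by
  rw [← sum_map_eq_of_parityMask_eq mon (fun t ht s hs => decode33_code33 ?_)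
    (fun s hs => decode33_code33 (hl s hs)) h]
  · refine list_sum_mem fun p hp => ?_
    obtain ⟨t, ht, rfl⟩ := List.mem_map.1 hp
    have := hc t ht
    rw [← homogeneousComponent_sqTotal_mon (by omega)]
    exact homogeneousComponent_sqTotal_mem_hit (isHomogeneous_mon t) (by omega)
  · have := hc t ht
    rw [degree_of_mem_sqTerms hs]
    omega

end Hit

section NotHit

/-- The exponents `a` such that `x ^ s` has an odd coefficient in `(x + x ^ 2) ^ a`. -/
def oddSources (s : ℕ) : List ℕ :=
  (List.range (s + 1)).filter fun a => ((oddChoose 6 a).countP fun b => a + b = s) % 2 = 1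

lemma sum_ite_oddSources (a s : ℕ) :
    ((oddChoose 6 a).map fun b => if a + b = s then (1 : ZMod 2) else 0).sum =
      ((oddSources s).map fun a' => if a' = a then (1 : ZMod 2) else 0).sum := by
  have hcount {α : Type} (l : List α) (p : α → Prop) [DecidablePred p] :
      (l.map fun b => if p b then (1 : ZMod 2) else 0).sum = (l.countP fun b => p b : ℕ) := by
    induction l with
    | nil => simp
    | cons x l ih => simp only [List.map_cons, List.sum_cons, ih, List.countP_cons]; split_ifs <;>
        simp_all [add_comm]
  rw [hcount, hcount]
  have hnodup : (oddSources s).Nodup := List.nodup_range.filter _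
  have : (oddSources s).countP (fun b => decide (b = a)) = (oddSources s).count a := by
    rw [List.count]
    congr
  rw [this, hnodup.count]
  by_cases has : a ≤ s
  · by_cases hodd : ((oddChoose 6 a).countP fun b => a + b = s) % 2 = 1
    · rw [if_pos (by simp [oddSources, hodd]; omega), ZMod.natCast_eq_natCast_iff']
      exact hodd
    · rw [if_neg (by simp [oddSources, hodd]), ZMod.natCast_eq_natCast_iff']
      omega
  · rw [if_neg (by simp [oddSources]; omega), List.countP_eq_zero.2 (by simp; omega)]

/-- The monomials whose total square contains a given monomial. -/
def sourceTerms (s : Exps) : List Exps :=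
  (oddSources s.1).flatMap fun a₀ => (oddSources s.2.1).flatMap fun a₁ =>
    (oddSources s.2.2.1).flatMap fun a₂ => (oddSources s.2.2.2).map fun a₃ => (a₀, a₁, a₂, a₃)

lemma coeff_sqTotal_mon (s : Exps) {t : Exps} (ht : t.degree < 64) :
    coeff s.toFinsupp (SqTotal 4 (mon t)) =
      ((sourceTerms s).map fun t' => if t' = t then (1 : ZMod 2) else 0).sum := by
  have hprod (p q : Prop) [Decidable p] [Decidable q] :
      (if p ∧ q then (1 : ZMod 2) else 0) = (if p then 1 else 0) * if q then 1 else 0 := by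
    split_ifs <;> simp_all
  obtain ⟨s₀, s₁, s₂, s₃⟩ := s
  obtain ⟨t₀, t₁, t₂, t₃⟩ := t
  rw [← lcoeff_apply, sqTotal_mon (k := 6) ht]
  simp only [map_sum_map, lcoeff_apply, coeff_mon, sourceTerms, sum_map_flatMap, List.map_map,
    Function.comp_def, Prod.mk.injEq, hprod, List.sum_map_mul_left, List.sum_map_mul_right,
    sum_ite_oddSources]

/-- The exponents bounded by `15` in base `16`. -/
def code16 (t : Exps) : ℕ :=
  t.1 + 16 * t.2.1 + 256 * t.2.2.1 + 4096 * t.2.2.2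

/-- The inverse of `code16`. -/
def decode16 (n : ℕ) : Exps :=
  (n % 16, n / 16 % 16, n / 256 % 16, n / 4096)

lemma decode16_code16 {t : Exps} (ht : t.1 < 16 ∧ t.2.1 < 16 ∧ t.2.2.1 < 16 ∧ t.2.2.2 < 16) :
    decode16 (code16 t) = t ∧ code16 t < 65536 := by
  obtain ⟨a, b, c, d⟩ := t
  simp only [decode16, code16, Prod.mk.injEq] at *
  omega

/-- The support of a linear functional in degree `33` that vanishes on hit polynomials. -/
def dualSupport : List Exps :=
  [(3, 13, 14, 3), (3, 14, 13, 3), (5, 11, 14, 3), (5, 14, 11, 3), (6, 11, 13, 3), (6, 13, 11, 3),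
   (7, 7, 5, 14), (7, 7, 6, 13), (7, 7, 11, 8), (7, 7, 12, 7), (7, 7, 13, 6), (7, 7, 14, 5),
   (7, 9, 3, 14), (7, 9, 6, 11), (7, 9, 10, 7), (7, 10, 3, 13), (7, 10, 5, 11), (7, 10, 9, 7),
   (7, 11, 7, 8), (7, 12, 7, 7), (7, 13, 7, 6), (7, 14, 7, 5), (9, 7, 14, 3), (9, 14, 7, 3),
   (10, 7, 13, 3), (10, 13, 7, 3), (11, 5, 3, 14), (11, 5, 6, 11), (11, 5, 10, 7), (11, 6, 3, 13),
   (11, 6, 5, 11), (11, 6, 9, 7), (11, 7, 11, 4), (11, 11, 7, 4), (12, 7, 11, 3), (12, 11, 7, 3),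
   (13, 3, 3, 14), (13, 3, 6, 11), (13, 3, 10, 7), (13, 6, 7, 7), (13, 7, 11, 2), (13, 11, 7, 2),
   (14, 3, 3, 13), (14, 3, 5, 11), (14, 3, 9, 7), (14, 5, 7, 7), (14, 7, 11, 1), (14, 11, 7, 1)]

/-- The sum of the coefficients over `dualSupport`. -/
def dualFunctional : P 4 →ₗ[ZMod 2] ZMod 2 :=
  (dualSupport.map fun s => lcoeff (ZMod 2) s.toFinsupp).sum

lemma dualFunctional_apply (p : P 4) :
    dualFunctional p = (dualSupport.map fun s => coeff s.toFinsupp p).sum := by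
  rw [dualFunctional, ← LinearMap.applyₗ_apply_apply (R := ZMod 2) p, map_sum_map]
  rfl

lemma oddSources_le {a s : ℕ} (h : a ∈ oddSources s) : a ≤ s := by
  have := List.mem_range.1 (List.mem_filter.1 h).1
  omega

lemma dualFunctional_sqTotal_mon {t : Exps} (ht : t.degree < 33) :
    dualFunctional (SqTotal 4 (mon t)) = 0 := by
  have hS : ∀ s ∈ dualSupport, s.degree = 33 ∧
      s.1 < 16 ∧ s.2.1 < 16 ∧ s.2.2.1 < 16 ∧ s.2.2.2 < 16 := by
    simp only [Exps.degree]
    decide +kernel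
  have hmask : xorSum (dualSupport.map fun s => parityMask code16 (sourceTerms s)) =
      parityMask code16 dualSupport := by
    decide +kernel
  rw [dualFunctional_apply]
  simp only [coeff_sqTotal_mon _ (show t.degree < 64 by omega)]
  rw [sum_map_eq_of_parityMask_eq _ (fun s hs t' ht' => decode16_code16 ?_)
    (fun s hs => decode16_code16 (hS s hs).2) hmask]
  · refine List.sum_eq_zero fun x hx => ?_
    obtain ⟨s, hs, rfl⟩ := List.mem_map.1 hx
    rw [if_neg]
    rintro rfl
    have := (hS _ hs).1
    omega
  · simp only [sourceTerms, List.mem_flatMap, List.mem_map] at ht'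
    obtain ⟨a₀, h₀, a₁, h₁, a₂, h₂, a₃, h₃, rfl⟩ := ht'
    have := hS s hs
    have := oddSources_le h₀
    have := oddSources_le h₁
    have := oddSources_le h₂
    have := oddSources_le h₃
    dsimp only
    omega

lemma dualFunctional_homogeneousComponent (d : ℕ) (p : P 4) :
    dualFunctional (homogeneousComponent d p) = if d = 33 then dualFunctional p else 0 := by
  have hS : ∀ s ∈ dualSupport, s.degree = 33 := by
    simp only [Exps.degree]
    decide +kernel
  simp only [dualFunctional_apply, coeff_homogeneousComponent]
  have hdeg (s : Exps) : s.toFinsupp.degree = s.degree := by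
    simp [Finsupp.degree_eq_sum, Fin.sum_univ_four, Exps.toFinsupp, Exps.degree]
  split_ifs with h
  · congr 1
    exact List.map_congr_left fun s hs => by rw [hdeg, hS s hs, if_pos h.symm]
  · refine List.sum_eq_zero fun x hx => ?_
    obtain ⟨s, hs, rfl⟩ := List.mem_map.1 hx
    rw [hdeg, hS s hs, if_neg (Ne.symm h)]

lemma dualFunctional_eq_zero_of_mem_hit {p : P 4} (hp : p ∈ hit 4) : dualFunctional p = 0 := by
  suffices hit 4 ≤ LinearMap.ker dualFunctional from this hp
  refine Submodule.span_le.2 ?_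
  rintro _ ⟨n, hn, g, rfl⟩
  rw [SetLike.mem_coe, LinearMap.mem_ker, Sq, map_sum]
  refine Finset.sum_eq_zero fun d _ => ?_
  rw [dualFunctional_homogeneousComponent]
  split_ifs with hd
  · rw [homogeneousComponent_apply, map_sum, map_sum]
    refine Finset.sum_eq_zero fun m hm => ?_
    rw [← mul_one (coeff m g), ← smul_eq_mul, ← smul_monomial, map_smul, map_smul,
      monomial_eq_mon, dualFunctional_sqTotal_mon, smul_zero]
    have := (Finset.mem_filter.1 hm).2
    rw [Finsupp.degree_eq_sum, Fin.sum_univ_four] at this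
    simp only [Exps.degree]
    omega
  · rfl

end NotHit

section Invariance

/-- The exponents of the monomials of `f17`. -/
def f17Terms : List Exps :=
  [(1, 1, 1, 30), (1, 1, 3, 28), (1, 3, 1, 28), (1, 3, 4, 25), (1, 7, 11, 14), (1, 7, 14, 11),
    (3, 1, 1, 28), (3, 1, 4, 25), (3, 5, 1, 24), (3, 5, 11, 14), (3, 5, 14, 11), (7, 1, 11, 14),
    (7, 1, 14, 11), (7, 7, 11, 8), (7, 7, 8, 11), (7, 7, 9, 10)]

lemma f17_eq_sum : f17 = (f17Terms.map mon).sum := by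
  simp only [f17, f17Terms, mon, List.map_cons, List.map_nil, List.sum_cons, List.sum_nil,
    pow_one, add_zero, add_assoc]

lemma f17_notMem_hit : f17 ∉ hit 4 := by
  intro h
  have h1 := dualFunctional_eq_zero_of_mem_hit h
  rw [f17_eq_sum, dualFunctional_apply] at h1
  simp only [← lcoeff_apply, map_sum_map] at h1
  simp only [lcoeff_apply, coeff_mon] at h1
  revert h1
  decide +kernel

/-- The exponents of the monomials occurring in `rho 4 j` of a monomial. -/
def rhoTerms (j : ℕ) (t : Exps) : List Exps :=
  match j with
  | 0 => [(t.2.1, t.1, t.2.2.1, t.2.2.2)]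
  | 1 => [(t.1, t.2.2.1, t.2.1, t.2.2.2)]
  | 2 => [(t.1, t.2.1, t.2.2.2, t.2.2.1)]
  | _ => (oddChoose 6 t.2.2.2).map fun b => (t.1, t.2.1, t.2.2.1 + b, t.2.2.2 - b)

lemma rho_mon {j : ℕ} (hj : j < 4) {t : Exps} (ht : t.degree < 64) :
    rho 4 j (mon t) = ((rhoTerms j t).map mon).sum := by
  have hswap (i : Fin 3) (k : Fin 4) :
      rho 4 i (X k) = X (Equiv.swap (Fin.castSucc i) (Fin.succ i) k) := by
    rw [rho_swap, rename_X]
  have h₀ (k : Fin 4) : rho 4 0 (X k) = X (Equiv.swap 0 1 k) := hswap 0 k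
  have h₁ (k : Fin 4) : rho 4 1 (X k) = X (Equiv.swap 1 2 k) := hswap 1 k
  have h₂ (k : Fin 4) : rho 4 2 (X k) = X (Equiv.swap 2 3 k) := hswap 2 k
  obtain ⟨a, b, c, d⟩ := t
  interval_cases j
  · simp [rhoTerms, mon, h₀, Equiv.swap_apply_of_ne_of_ne, mul_comm (X 1 ^ a : P 4)]
  · simp [rhoTerms, mon, h₁, Equiv.swap_apply_of_ne_of_ne, mul_right_comm]
  · simp [rhoTerms, mon, h₂, Equiv.swap_apply_of_ne_of_ne, mul_right_comm]
  · have hd : d < 2 ^ 6 := by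
      simp only [Exps.degree] at ht
      omega
    simp only [rhoTerms, mon, map_mul, map_pow, rho_three_X, Fin.reduceEq, if_true, if_false,
      add_zero, add_pow_eq_sum_oddChoose hd, List.map_map, Function.comp_def,
      ← List.sum_map_mul_left]
    congr 1
    exact List.map_congr_left fun e _ => by ring

lemma rho_f17_add_mem_hit {j : ℕ} (hj : j < 4) (c : List Exps)
    (hdeg : ∀ s ∈ f17Terms.flatMap (rhoTerms j) ++ f17Terms, s.1 + s.2.1 + s.2.2.1 + s.2.2.2 = 33)
    (hc : ∀ t ∈ c, t.1 + t.2.1 + t.2.2.1 + t.2.2.2 < 33)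
    (h : xorSum (c.map fun t => parityMask code33 (sqTerms (33 - t.degree) t)) =
      parityMask code33 (f17Terms.flatMap (rhoTerms j) ++ f17Terms)) :
    rho 4 j f17 + f17 ∈ hit 4 := by
  have h33 : ∀ t ∈ f17Terms, t.degree < 64 := fun t ht =>
    (hdeg t (List.mem_append_right _ ht)).trans_lt (by norm_num)
  convert sum_mon_mem_hit c hdeg hc h
  rw [List.map_append, List.sum_append, ← f17_eq_sum, sum_map_flatMap]
  congr 1
  rw [f17_eq_sum, map_sum_map]
  congr 1
  exact List.map_congr_left fun t ht => rho_mon hj (h33 t ht)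

/-- Monomials of degree below `33` whose Steenrod squares in degree `33` add up to
`rho 4 0 f17 + f17`. -/
def hitTerms₀ : List Exps :=
  [(2, 2, 1, 12), (3, 1, 8, 5), (3, 3, 1, 24), (3, 3, 2, 24), (3, 3, 5, 6), (3, 3, 7, 4),
    (3, 3, 8, 3), (3, 3, 16, 3), (3, 5, 11, 11), (3, 5, 11, 12), (3, 5, 12, 11), (3, 5, 13, 9),
    (3, 5, 14, 9), (3, 5, 16, 5), (3, 6, 11, 11), (3, 6, 13, 9), (3, 6, 14, 9), (3, 8, 11, 7),
    (3, 8, 11, 9), (3, 8, 13, 7), (3, 9, 10, 9), (3, 9, 12, 5), (3, 10, 9, 10), (4, 3, 7, 3),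
    (4, 5, 9, 9), (4, 5, 11, 11), (5, 1, 16, 9), (5, 3, 5, 5), (5, 3, 9, 8), (5, 3, 9, 14),
    (5, 3, 10, 12), (5, 3, 10, 13), (5, 3, 11, 13), (5, 3, 13, 8), (5, 3, 13, 10), (5, 3, 13, 11),
    (5, 4, 9, 9), (5, 4, 11, 11), (5, 4, 14, 9), (5, 5, 9, 12), (5, 5, 9, 13), (5, 5, 10, 9),
    (5, 5, 12, 5), (5, 6, 9, 11), (5, 6, 12, 8), (5, 8, 9, 7), (6, 3, 11, 11), (6, 3, 13, 9),
    (6, 4, 7, 13), (6, 5, 9, 11), (6, 8, 11, 7), (8, 2, 8, 13), (8, 3, 7, 11), (8, 3, 8, 13),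
    (8, 3, 9, 5), (8, 3, 9, 11), (8, 3, 13, 5), (8, 5, 7, 11), (9, 3, 5, 8), (9, 3, 5, 12),
    (9, 3, 9, 4), (9, 3, 9, 10), (9, 3, 13, 4), (9, 4, 9, 10), (9, 5, 5, 8), (9, 5, 5, 12),
    (9, 5, 12, 5), (9, 5, 13, 4), (9, 6, 6, 8), (9, 6, 9, 7), (9, 8, 4, 8), (9, 9, 4, 9),
    (9, 10, 3, 10), (10, 5, 5, 9), (10, 6, 9, 7), (10, 9, 3, 9), (10, 9, 5, 8), (12, 3, 3, 9),
    (12, 5, 3, 9), (12, 5, 5, 9), (16, 2, 4, 9), (16, 3, 3, 10), (16, 3, 5, 5), (16, 5, 5, 5),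
    (17, 3, 5, 4), (17, 5, 5, 4)]

/-- Monomials of degree below `33` whose Steenrod squares in degree `33` add up to
`rho 4 1 f17 + f17`. -/
def hitTerms₁ : List Exps :=
  [(1, 1, 9, 20), (1, 2, 3, 25), (1, 2, 3, 26), (1, 2, 5, 21), (1, 2, 9, 19), (1, 3, 2, 25),
    (1, 3, 2, 26), (1, 3, 18, 10), (1, 4, 5, 19), (1, 4, 13, 11), (1, 4, 13, 13), (1, 4, 17, 7),
    (1, 5, 2, 21), (1, 5, 4, 13), (1, 5, 8, 11), (1, 5, 8, 15), (1, 5, 11, 11), (1, 5, 12, 11),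
    (1, 5, 13, 11), (1, 6, 8, 11), (1, 6, 11, 11), (1, 6, 12, 13), (1, 6, 13, 11), (1, 7, 4, 17),
    (1, 7, 6, 17), (1, 7, 11, 11), (1, 7, 11, 12), (1, 7, 12, 11), (1, 8, 5, 11), (1, 8, 5, 18),
    (1, 8, 9, 7), (1, 9, 1, 20), (1, 9, 2, 19), (1, 9, 4, 15), (1, 9, 6, 9), (1, 9, 7, 11),
    (1, 9, 8, 7), (1, 9, 9, 13), (1, 9, 10, 9), (1, 9, 11, 8), (1, 9, 12, 7), (1, 9, 13, 4),
    (1, 9, 17, 2), (1, 10, 3, 13), (1, 10, 5, 13), (1, 10, 6, 10), (1, 10, 7, 13), (1, 11, 4, 13),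
    (1, 11, 7, 13), (1, 11, 9, 9), (1, 12, 3, 11), (1, 12, 3, 13), (1, 13, 4, 10), (1, 13, 4, 11),
    (1, 13, 6, 9), (1, 13, 7, 10), (1, 13, 7, 11), (1, 14, 8, 9), (1, 14, 9, 7), (1, 14, 10, 7),
    (1, 16, 2, 6), (1, 17, 4, 7), (2, 1, 4, 18), (2, 1, 9, 14), (2, 2, 2, 21), (2, 2, 9, 19),
    (2, 3, 17, 9), (2, 5, 13, 9), (2, 7, 5, 17), (2, 7, 9, 11), (2, 7, 9, 13), (2, 7, 11, 11),
    (2, 9, 3, 17), (2, 9, 11, 9), (2, 10, 1, 19), (2, 10, 4, 9), (2, 10, 11, 6), (2, 10, 13, 6),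
    (2, 10, 16, 1), (2, 11, 6, 9), (2, 11, 7, 11), (2, 11, 8, 6), (2, 12, 7, 8), (2, 12, 7, 10),
    (2, 13, 7, 9), (2, 14, 7, 8), (2, 16, 3, 11), (3, 1, 4, 10), (3, 1, 4, 21), (3, 1, 5, 12),
    (3, 1, 5, 18), (3, 1, 8, 19), (3, 2, 3, 17), (3, 2, 10, 10), (3, 2, 18, 9), (3, 3, 6, 5),
    (3, 3, 16, 3), (3, 3, 17, 8), (3, 3, 18, 8), (3, 4, 1, 21), (3, 5, 1, 20), (3, 5, 2, 7),
    (3, 5, 4, 17), (3, 5, 8, 9), (3, 5, 9, 1), (3, 5, 11, 11), (3, 5, 11, 12), (3, 5, 12, 9),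
    (3, 5, 12, 11), (3, 5, 13, 8), (3, 6, 8, 11), (3, 6, 9, 10), (3, 6, 11, 11), (3, 7, 3, 18),
    (3, 7, 3, 19), (3, 7, 4, 11), (3, 7, 5, 17), (3, 7, 6, 13), (3, 7, 8, 7), (3, 7, 9, 12),
    (3, 7, 10, 11), (3, 7, 11, 8), (3, 7, 11, 9), (3, 7, 11, 10), (3, 7, 11, 11), (3, 7, 12, 9),
    (3, 7, 13, 7), (3, 7, 13, 9), (3, 7, 14, 7), (3, 8, 1, 13), (3, 8, 3, 15), (3, 8, 5, 9),
    (3, 8, 5, 15), (3, 8, 10, 7), (3, 8, 13, 5), (3, 8, 14, 4), (3, 8, 17, 3), (3, 9, 1, 13),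
    (3, 9, 1, 18), (3, 9, 3, 13), (3, 9, 5, 9), (3, 9, 5, 10), (3, 9, 6, 7), (3, 9, 9, 4),
    (3, 9, 11, 4), (3, 9, 17, 2), (3, 10, 3, 13), (3, 10, 11, 7), (3, 11, 2, 11), (3, 11, 5, 13),
    (3, 11, 6, 8), (3, 11, 6, 9), (3, 11, 9, 7), (3, 11, 9, 9), (3, 11, 10, 7), (3, 11, 11, 7),
    (3, 12, 4, 13), (3, 12, 5, 9), (3, 12, 9, 7), (3, 13, 9, 4), (3, 14, 1, 13), (3, 14, 5, 7),
    (3, 16, 5, 7), (3, 17, 2, 3), (3, 17, 3, 8), (3, 17, 5, 7), (3, 17, 8, 1), (3, 18, 4, 7),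
    (4, 1, 1, 19), (4, 1, 8, 19), (4, 2, 2, 21), (4, 2, 9, 5), (4, 2, 17, 6), (4, 3, 4, 7),
    (4, 3, 13, 9), (4, 4, 17, 3), (4, 5, 1, 7), (4, 5, 2, 8), (4, 5, 9, 11), (4, 5, 9, 13),
    (4, 5, 11, 11), (4, 6, 4, 9), (4, 6, 10, 9), (4, 7, 3, 11), (4, 7, 4, 14), (4, 7, 6, 10),
    (4, 7, 13, 7), (4, 8, 5, 11), (4, 8, 13, 7), (4, 9, 10, 4), (4, 10, 2, 13), (4, 10, 5, 7),
    (4, 10, 14, 1), (4, 11, 1, 12), (4, 11, 1, 14), (4, 11, 7, 7), (4, 11, 9, 5), (4, 12, 9, 7),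
    (4, 12, 10, 5), (4, 12, 11, 5), (4, 13, 3, 9), (4, 13, 3, 11), (4, 13, 9, 5), (4, 17, 3, 7),
    (5, 1, 4, 19), (5, 1, 5, 10), (5, 1, 5, 18), (5, 1, 8, 3), (5, 1, 9, 14), (5, 2, 3, 7),
    (5, 2, 6, 17), (5, 3, 7, 2), (5, 3, 8, 3), (5, 3, 9, 8), (5, 3, 9, 12), (5, 3, 12, 10),
    (5, 3, 13, 8), (5, 3, 17, 4), (5, 4, 1, 7), (5, 4, 1, 21), (5, 4, 8, 2), (5, 4, 9, 5),
    (5, 4, 17, 3), (5, 5, 1, 20), (5, 5, 4, 18), (5, 5, 8, 13), (5, 5, 9, 4), (5, 5, 14, 8),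
    (5, 6, 1, 5), (5, 6, 1, 17), (5, 6, 5, 1), (5, 6, 11, 9), (5, 6, 13, 7), (5, 6, 17, 1),
    (5, 7, 1, 16), (5, 7, 3, 10), (5, 7, 4, 4), (5, 7, 8, 9), (5, 7, 8, 11), (5, 7, 9, 11),
    (5, 7, 18, 2), (5, 8, 3, 13), (5, 8, 3, 14), (5, 8, 5, 11), (5, 8, 13, 5), (5, 9, 1, 8),
    (5, 9, 2, 13), (5, 9, 5, 13), (5, 9, 10, 4), (5, 9, 11, 4), (5, 9, 11, 7), (5, 9, 14, 1),
    (5, 10, 3, 10), (5, 10, 3, 13), (5, 10, 5, 9), (5, 10, 12, 1), (5, 11, 1, 13), (5, 11, 1, 14),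
    (5, 11, 5, 8), (5, 11, 5, 10), (5, 11, 8, 7), (5, 12, 1, 13), (5, 13, 1, 10), (5, 13, 3, 8),
    (5, 13, 3, 10), (5, 13, 5, 9), (5, 13, 8, 3), (5, 13, 8, 5), (5, 13, 9, 4), (5, 17, 1, 6),
    (5, 17, 4, 3), (5, 17, 8, 1), (6, 1, 8, 14), (6, 2, 6, 17), (6, 2, 9, 13), (6, 3, 1, 7),
    (6, 3, 5, 3), (6, 3, 7, 9), (6, 3, 7, 13), (6, 3, 9, 7), (6, 3, 11, 11), (6, 3, 13, 7),
    (6, 4, 5, 9), (6, 4, 7, 11), (6, 5, 8, 8), (6, 6, 2, 9), (6, 6, 7, 11), (6, 6, 9, 8),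
    (6, 7, 4, 10), (6, 7, 5, 11), (6, 7, 11, 7), (6, 7, 17, 1), (6, 8, 2, 15), (6, 9, 1, 9),
    (6, 9, 2, 11), (6, 9, 3, 13), (6, 9, 8, 6), (6, 9, 9, 5), (6, 9, 12, 2), (6, 10, 9, 7),
    (6, 11, 1, 9), (6, 11, 1, 11), (6, 11, 5, 7), (6, 13, 1, 9), (6, 13, 2, 10), (7, 1, 2, 7),
    (7, 1, 6, 17), (7, 1, 6, 18), (7, 1, 8, 13), (7, 1, 9, 8), (7, 1, 9, 14), (7, 1, 10, 13),
    (7, 1, 11, 12), (7, 1, 11, 13), (7, 1, 13, 11), (7, 1, 17, 5), (7, 1, 17, 6), (7, 2, 8, 11),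
    (7, 2, 9, 8), (7, 2, 11, 11), (7, 2, 12, 9), (7, 2, 13, 8), (7, 3, 1, 6), (7, 3, 7, 8),
    (7, 3, 7, 14), (7, 3, 8, 7), (7, 3, 9, 11), (7, 3, 10, 11), (7, 3, 11, 8), (7, 3, 11, 9),
    (7, 3, 11, 10), (7, 3, 11, 11), (7, 3, 14, 7), (7, 4, 7, 13), (7, 4, 11, 9), (7, 5, 2, 16),
    (7, 5, 5, 1), (7, 5, 7, 13), (7, 5, 9, 10), (7, 5, 10, 9), (7, 5, 11, 8), (7, 5, 13, 7),
    (7, 6, 1, 13), (7, 6, 1, 14), (7, 6, 2, 8), (7, 6, 7, 11), (7, 6, 11, 7), (7, 7, 2, 9),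
    (7, 7, 2, 13), (7, 7, 4, 11), (7, 7, 7, 9), (7, 7, 10, 7), (7, 7, 11, 7), (7, 8, 1, 13),
    (7, 8, 7, 8), (7, 8, 7, 9), (7, 9, 1, 13), (7, 9, 2, 7), (7, 9, 2, 13), (7, 9, 8, 5),
    (7, 9, 9, 6), (7, 9, 9, 7), (7, 9, 12, 1), (7, 9, 14, 1), (7, 9, 14, 2), (7, 10, 6, 8),
    (7, 10, 7, 7), (7, 10, 10, 5), (7, 11, 1, 11), (7, 11, 1, 12), (7, 11, 3, 7), (7, 11, 3, 11),
    (7, 11, 4, 7), (7, 11, 4, 9), (7, 11, 5, 9), (7, 11, 7, 7), (7, 13, 2, 7), (7, 13, 3, 7),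
    (8, 1, 1, 22), (8, 1, 6, 8), (8, 1, 10, 10), (8, 1, 11, 11), (8, 1, 11, 12), (8, 3, 9, 7),
    (8, 3, 12, 7), (8, 4, 3, 11), (8, 4, 9, 3), (8, 4, 10, 7), (8, 5, 9, 5), (8, 6, 5, 10),
    (8, 7, 3, 12), (8, 7, 6, 8), (8, 7, 6, 9), (8, 7, 9, 1), (8, 7, 9, 5), (8, 8, 1, 15),
    (8, 9, 7, 7), (8, 10, 2, 5), (8, 11, 3, 7), (8, 13, 2, 6), (8, 13, 9, 1), (8, 14, 3, 7),
    (8, 17, 2, 5), (9, 1, 4, 11), (9, 1, 6, 13), (9, 1, 11, 8), (9, 1, 11, 10), (9, 1, 13, 7),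
    (9, 1, 14, 5), (9, 1, 18, 4), (9, 2, 7, 11), (9, 2, 7, 13), (9, 2, 13, 7), (9, 2, 17, 3),
    (9, 3, 1, 6), (9, 3, 1, 16), (9, 3, 2, 4), (9, 3, 7, 13), (9, 3, 9, 4), (9, 3, 9, 8),
    (9, 3, 12, 5), (9, 3, 13, 7), (9, 4, 4, 10), (9, 4, 5, 11), (9, 4, 9, 7), (9, 5, 1, 2),
    (9, 5, 3, 8), (9, 5, 3, 12), (9, 5, 5, 10), (9, 5, 6, 9), (9, 5, 8, 7), (9, 5, 11, 4),
    (9, 5, 12, 3), (9, 6, 1, 9), (9, 6, 1, 13), (9, 6, 7, 7), (9, 6, 9, 1), (9, 6, 9, 5),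
    (9, 7, 1, 11), (9, 7, 1, 12), (9, 7, 2, 10), (9, 7, 5, 11), (9, 7, 6, 7), (9, 7, 7, 9),
    (9, 7, 8, 3), (9, 8, 2, 11), (9, 8, 3, 11), (9, 9, 4, 3), (9, 9, 5, 3), (9, 9, 10, 3),
    (9, 10, 4, 6), (9, 10, 5, 7), (9, 11, 3, 5), (9, 11, 3, 6), (9, 11, 4, 5), (9, 11, 5, 5),
    (9, 11, 5, 6), (9, 13, 1, 6), (9, 13, 4, 6), (10, 1, 7, 12), (10, 1, 11, 9), (10, 1, 17, 3),
    (10, 2, 9, 7), (10, 3, 4, 9), (10, 3, 4, 10), (10, 3, 16, 3), (10, 6, 1, 8), (10, 6, 1, 12),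
    (10, 6, 2, 13), (10, 6, 4, 11), (10, 7, 1, 7), (10, 7, 1, 13), (10, 8, 2, 9), (10, 9, 4, 7),
    (10, 10, 8, 3), (10, 13, 1, 7), (10, 14, 1, 7), (11, 1, 8, 11), (11, 3, 4, 11), (11, 3, 4, 13),
    (11, 4, 4, 9), (11, 5, 2, 9), (11, 5, 4, 9), (11, 5, 9, 4), (11, 6, 2, 12), (11, 7, 2, 11),
    (11, 9, 2, 6), (11, 9, 4, 4), (11, 9, 8, 3), (11, 9, 9, 2), (11, 9, 10, 1), (11, 9, 10, 2),
    (11, 11, 2, 7), (11, 11, 3, 7), (12, 1, 11, 5), (12, 1, 13, 3), (12, 2, 7, 10), (12, 2, 10, 3),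
    (12, 2, 10, 5), (12, 5, 1, 11), (12, 5, 7, 7), (12, 5, 9, 5), (13, 1, 4, 11), (13, 2, 3, 8),
    (13, 3, 1, 12), (13, 3, 1, 14), (13, 3, 2, 13), (13, 3, 4, 11), (13, 3, 5, 8), (13, 3, 7, 8),
    (13, 3, 8, 7), (13, 3, 9, 4), (13, 5, 1, 11), (13, 5, 5, 8), (13, 6, 9, 1), (13, 7, 2, 7),
    (13, 7, 10, 2), (13, 9, 4, 3), (14, 1, 6, 8), (14, 4, 1, 13), (14, 5, 1, 11), (14, 7, 4, 7),
    (14, 7, 9, 1), (14, 9, 2, 5), (14, 9, 2, 6), (16, 1, 11, 3), (16, 1, 11, 4), (16, 2, 5, 2),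
    (17, 1, 5, 8), (17, 3, 3, 8), (17, 4, 2, 6), (17, 5, 1, 6), (17, 6, 1, 7), (17, 7, 1, 6),
    (17, 7, 1, 7), (17, 9, 1, 4), (18, 3, 1, 10), (18, 5, 2, 7), (18, 7, 1, 6)]

/-- Monomials of degree below `33` whose Steenrod squares in degree `33` add up to
`rho 4 2 f17 + f17`. -/
def hitTerms₂ : List Exps :=
  [(1, 1, 1, 15), (1, 1, 2, 15), (1, 1, 3, 26), (1, 1, 4, 23), (1, 1, 5, 22), (1, 1, 5, 24),
    (1, 1, 8, 13), (1, 1, 8, 15), (1, 1, 9, 14), (1, 1, 10, 10), (1, 1, 13, 8), (1, 1, 13, 9),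
    (1, 1, 13, 10), (1, 1, 14, 15), (1, 1, 15, 2), (1, 1, 15, 8), (1, 1, 15, 14), (1, 1, 22, 5),
    (1, 1, 23, 1), (1, 1, 23, 4), (1, 1, 24, 5), (1, 1, 26, 3), (1, 2, 1, 21), (1, 2, 1, 23),
    (1, 2, 2, 26), (1, 2, 11, 9), (1, 2, 15, 1), (1, 2, 21, 2), (1, 2, 26, 1), (1, 3, 1, 15),
    (1, 3, 1, 20), (1, 3, 1, 21), (1, 3, 1, 26), (1, 3, 1, 27), (1, 3, 2, 25), (1, 3, 25, 2),
    (1, 3, 26, 1), (1, 4, 1, 23), (1, 4, 11, 9), (1, 4, 23, 1), (1, 5, 1, 10), (1, 5, 1, 25),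
    (1, 5, 2, 20), (1, 5, 12, 1), (1, 5, 23, 1), (1, 6, 1, 23), (1, 6, 23, 1), (1, 6, 24, 1),
    (1, 8, 11, 9), (1, 9, 12, 9), (1, 10, 11, 10), (1, 10, 19, 2), (1, 16, 1, 13), (1, 16, 2, 13),
    (1, 17, 1, 10), (1, 17, 9, 4), (1, 18, 2, 11), (1, 18, 10, 3), (2, 1, 1, 27), (2, 1, 1, 28),
    (2, 1, 3, 26), (2, 1, 11, 9), (2, 1, 26, 2), (2, 1, 27, 1), (2, 2, 9, 12), (2, 2, 13, 15),
    (2, 2, 15, 13), (2, 2, 25, 3), (2, 3, 1, 20), (2, 5, 1, 21), (2, 5, 13, 9), (2, 5, 17, 5),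
    (2, 5, 21, 1), (2, 9, 1, 13), (2, 9, 1, 17), (2, 9, 9, 5), (2, 9, 9, 9), (2, 9, 11, 9),
    (2, 9, 19, 1), (2, 10, 1, 14), (2, 12, 1, 14), (2, 17, 1, 11), (2, 17, 9, 3), (3, 1, 1, 26),
    (3, 1, 2, 21), (3, 1, 6, 7), (3, 1, 20, 1), (3, 1, 25, 2), (3, 1, 26, 1), (3, 3, 1, 10),
    (3, 3, 1, 24), (3, 3, 7, 4), (3, 4, 2, 22), (3, 4, 4, 7), (3, 4, 4, 11), (3, 4, 17, 1),
    (3, 5, 5, 4), (3, 5, 13, 8), (3, 5, 17, 1), (3, 5, 17, 2), (3, 5, 17, 4), (3, 5, 18, 1),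
    (3, 5, 20, 1), (3, 6, 17, 1), (3, 9, 11, 8), (3, 10, 11, 8), (3, 12, 13, 1), (3, 16, 7, 1),
    (3, 16, 11, 2), (4, 1, 1, 15), (4, 1, 2, 13), (4, 1, 9, 9), (4, 1, 10, 13), (4, 1, 11, 13),
    (4, 1, 13, 11), (4, 1, 17, 7), (4, 1, 19, 5), (4, 1, 21, 5), (4, 1, 23, 1), (4, 2, 2, 21),
    (4, 2, 9, 14), (4, 3, 5, 5), (4, 3, 17, 1), (4, 5, 1, 21), (4, 5, 11, 9), (4, 5, 13, 1),
    (4, 5, 17, 5), (4, 7, 17, 1), (4, 9, 10, 4), (4, 9, 15, 1), (4, 10, 1, 10), (4, 11, 13, 1),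
    (4, 13, 11, 1), (4, 16, 10, 1), (4, 17, 1, 7), (4, 17, 2, 9), (4, 17, 5, 3), (4, 17, 5, 5),
    (4, 17, 7, 1), (4, 17, 9, 1), (5, 1, 1, 23), (5, 1, 4, 21), (5, 1, 12, 13), (5, 1, 13, 1),
    (5, 1, 19, 1), (5, 2, 1, 14), (5, 2, 1, 19), (5, 2, 1, 21), (5, 2, 12, 1), (5, 2, 21, 1),
    (5, 3, 1, 20), (5, 4, 3, 5), (5, 4, 4, 18), (5, 4, 19, 1), (5, 5, 1, 7), (5, 8, 9, 1),
    (5, 8, 11, 1), (5, 8, 13, 1), (5, 9, 7, 8), (5, 12, 13, 1), (5, 17, 1, 8), (5, 17, 8, 1),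
    (5, 18, 2, 7), (5, 18, 7, 2), (6, 1, 1, 23), (6, 1, 23, 1), (6, 2, 1, 11), (6, 2, 1, 20),
    (6, 2, 23, 1), (6, 4, 2, 11), (6, 9, 2, 9), (6, 9, 9, 1), (6, 17, 1, 5), (6, 17, 1, 7),
    (6, 17, 4, 4), (6, 17, 7, 1), (7, 4, 1, 17), (7, 5, 2, 3), (7, 5, 10, 10), (7, 6, 9, 9),
    (7, 7, 9, 9), (7, 8, 1, 9), (7, 9, 4, 9), (7, 9, 6, 9), (7, 10, 5, 10), (7, 16, 1, 7),
    (7, 16, 2, 7), (8, 1, 4, 4), (8, 1, 9, 7), (8, 1, 10, 10), (8, 1, 11, 5), (8, 1, 11, 11),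
    (8, 1, 13, 9), (8, 2, 11, 11), (8, 5, 1, 5), (8, 5, 7, 9), (8, 5, 9, 9), (8, 7, 7, 9),
    (8, 7, 7, 10), (8, 7, 12, 2), (8, 7, 15, 1), (8, 8, 4, 11), (8, 8, 8, 5), (8, 8, 15, 1),
    (8, 9, 3, 5), (8, 9, 13, 1), (8, 11, 11, 1), (8, 12, 1, 6), (8, 12, 11, 1), (8, 17, 1, 3),
    (8, 17, 3, 3), (8, 18, 3, 3), (9, 1, 20, 1), (9, 2, 19, 1), (9, 3, 1, 18), (9, 3, 9, 8),
    (9, 4, 1, 11), (9, 4, 1, 17), (9, 5, 1, 4), (9, 5, 1, 10), (9, 5, 4, 5), (9, 5, 4, 9),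
    (9, 5, 5, 8), (9, 6, 5, 9), (9, 8, 1, 7), (9, 9, 1, 13), (9, 9, 3, 5), (9, 9, 5, 6),
    (9, 9, 7, 6), (10, 3, 2, 11), (10, 3, 2, 12), (10, 3, 2, 14), (10, 6, 2, 11), (10, 8, 1, 10),
    (10, 9, 1, 5), (10, 9, 3, 5), (10, 9, 9, 1), (10, 10, 7, 5), (11, 4, 1, 13), (11, 8, 1, 9),
    (11, 8, 1, 11), (11, 8, 2, 11), (11, 9, 1, 5), (11, 9, 2, 9), (12, 1, 7, 9), (12, 1, 9, 9),
    (12, 1, 11, 5), (12, 1, 13, 5), (12, 9, 3, 5), (13, 4, 1, 11), (13, 5, 1, 9), (13, 9, 2, 5),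
    (14, 5, 1, 9), (14, 9, 1, 5), (16, 1, 7, 7), (16, 2, 7, 7), (17, 5, 2, 5), (17, 6, 1, 7),
    (17, 9, 1, 2), (18, 5, 2, 7)]

/-- Monomials of degree below `33` whose Steenrod squares in degree `33` add up to
`rho 4 3 f17 + f17`. -/
def hitTerms₃ : List Exps :=
  [(1, 1, 3, 26), (1, 1, 4, 25), (1, 1, 5, 18), (1, 1, 9, 14), (1, 1, 10, 6), (1, 1, 13, 10),
    (1, 1, 14, 1), (1, 1, 21, 2), (1, 1, 23, 4), (1, 1, 23, 6), (1, 1, 27, 2), (1, 2, 15, 6),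
    (1, 2, 15, 10), (1, 2, 19, 3), (1, 2, 19, 6), (1, 3, 5, 16), (1, 3, 9, 18), (1, 3, 11, 12),
    (1, 3, 12, 9), (1, 3, 13, 12), (1, 3, 25, 2), (1, 3, 26, 1), (1, 4, 7, 17), (1, 4, 10, 12),
    (1, 4, 11, 9), (1, 4, 19, 5), (1, 5, 3, 8), (1, 5, 8, 9), (1, 5, 9, 14), (1, 5, 11, 8),
    (1, 5, 19, 4), (1, 5, 20, 1), (1, 5, 21, 2), (1, 5, 22, 1), (1, 6, 5, 5), (1, 6, 5, 17),
    (1, 6, 7, 17), (1, 7, 11, 6), (1, 7, 16, 5), (1, 7, 19, 4), (1, 7, 21, 2), (1, 7, 21, 3),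
    (1, 7, 22, 1), (1, 8, 5, 17), (1, 8, 11, 3), (1, 9, 5, 2), (1, 9, 5, 10), (1, 9, 5, 14),
    (1, 9, 8, 6), (1, 9, 9, 12), (1, 9, 11, 10), (1, 10, 5, 9), (1, 10, 20, 1), (1, 11, 2, 3),
    (1, 11, 11, 6), (1, 11, 14, 5), (1, 12, 9, 3), (1, 12, 13, 3), (1, 13, 7, 8), (1, 13, 9, 4),
    (1, 13, 11, 3), (1, 13, 11, 6), (1, 13, 13, 4), (1, 14, 10, 3), (1, 14, 11, 5), (1, 15, 5, 8),
    (1, 15, 7, 8), (1, 15, 8, 6), (1, 15, 9, 3), (1, 15, 10, 3), (1, 15, 12, 3), (1, 17, 5, 6),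
    (1, 17, 7, 3), (1, 17, 9, 3), (1, 18, 3, 9), (1, 18, 4, 6), (1, 18, 9, 3), (1, 19, 5, 4),
    (1, 20, 2, 2), (1, 20, 2, 4), (1, 20, 3, 5), (1, 20, 5, 3), (1, 22, 3, 5), (1, 22, 5, 3),
    (2, 1, 5, 9), (2, 1, 11, 6), (2, 1, 20, 2), (2, 1, 22, 6), (2, 2, 3, 25), (2, 2, 13, 8),
    (2, 2, 13, 12), (2, 2, 18, 3), (2, 2, 27, 1), (2, 3, 10, 17), (2, 3, 11, 16), (2, 4, 9, 3),
    (2, 4, 13, 1), (2, 4, 13, 12), (2, 5, 5, 5), (2, 5, 6, 5), (2, 5, 7, 18), (2, 5, 10, 0),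
    (2, 6, 9, 3), (2, 6, 11, 9), (2, 7, 11, 10), (2, 7, 13, 3), (2, 7, 17, 5), (2, 7, 20, 3),
    (2, 8, 5, 2), (2, 9, 4, 16), (2, 9, 18, 2), (2, 10, 14, 5), (2, 11, 9, 3), (2, 12, 12, 5),
    (2, 13, 13, 4), (2, 14, 11, 5), (2, 16, 7, 4), (2, 17, 7, 5), (2, 18, 3, 9), (2, 21, 3, 6),
    (2, 21, 6, 3), (3, 1, 9, 10), (3, 1, 9, 16), (3, 1, 12, 9), (3, 1, 19, 8), (3, 1, 21, 4),
    (3, 1, 22, 1), (3, 2, 7, 5), (3, 2, 9, 6), (3, 2, 10, 5), (3, 2, 10, 17), (3, 2, 18, 6),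
    (3, 2, 26, 1), (3, 3, 3, 16), (3, 4, 13, 9), (3, 4, 17, 5), (3, 5, 5, 16), (3, 5, 10, 4),
    (3, 5, 10, 8), (3, 5, 13, 10), (3, 5, 14, 9), (3, 5, 14, 10), (3, 5, 17, 6), (3, 5, 18, 5),
    (3, 5, 19, 5), (3, 5, 20, 1), (3, 5, 21, 0), (3, 5, 21, 3), (3, 6, 13, 9), (3, 6, 19, 3),
    (3, 7, 18, 4), (3, 8, 11, 3), (3, 8, 17, 3), (3, 9, 3, 16), (3, 9, 18, 1), (3, 9, 19, 0),
    (3, 10, 3, 16), (3, 10, 18, 1), (3, 10, 19, 0), (3, 11, 8, 9), (3, 11, 8, 10), (3, 12, 11, 3),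
    (3, 12, 11, 6), (3, 12, 13, 3), (3, 13, 4, 9), (3, 17, 2, 9), (3, 18, 1, 10), (4, 1, 5, 7),
    (4, 1, 7, 17), (4, 1, 9, 13), (4, 1, 11, 9), (4, 1, 14, 5), (4, 1, 19, 1), (4, 1, 19, 5),
    (4, 1, 22, 2), (4, 2, 9, 2), (4, 5, 13, 9), (4, 5, 19, 3), (4, 6, 9, 10), (4, 7, 12, 9),
    (4, 8, 9, 10), (4, 9, 9, 3), (4, 9, 13, 6), (4, 11, 13, 3), (4, 12, 6, 9), (4, 13, 8, 2),
    (4, 13, 9, 5), (4, 17, 1, 9), (4, 17, 7, 3), (4, 18, 7, 3), (5, 1, 2, 9), (5, 1, 7, 4),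
    (5, 1, 9, 14), (5, 1, 10, 3), (5, 1, 11, 8), (5, 1, 11, 12), (5, 1, 13, 4), (5, 1, 13, 10),
    (5, 1, 14, 1), (5, 1, 16, 6), (5, 1, 18, 6), (5, 4, 3, 17), (5, 4, 5, 17), (5, 5, 2, 6),
    (5, 5, 6, 1), (5, 5, 7, 9), (5, 5, 17, 5), (5, 5, 19, 0), (5, 5, 20, 1), (5, 6, 11, 3),
    (5, 6, 11, 10), (5, 6, 17, 3), (5, 7, 5, 0), (5, 8, 3, 9), (5, 9, 3, 12), (5, 9, 5, 10),
    (5, 9, 6, 9), (5, 9, 10, 1), (5, 9, 12, 5), (5, 10, 5, 9), (5, 10, 13, 3), (5, 11, 8, 5),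
    (5, 12, 3, 9), (5, 13, 2, 9), (5, 13, 8, 2), (5, 13, 8, 5), (5, 17, 1, 2), (5, 17, 6, 1),
    (6, 1, 5, 6), (6, 2, 16, 5), (6, 5, 1, 5), (6, 5, 9, 9), (6, 5, 11, 9), (6, 5, 17, 3),
    (6, 6, 7, 10), (6, 6, 7, 12), (6, 8, 9, 6), (6, 9, 1, 10), (6, 9, 11, 6), (6, 12, 10, 1),
    (6, 14, 8, 1), (6, 16, 6, 1), (7, 1, 12, 9), (7, 1, 13, 6), (7, 1, 13, 8), (7, 1, 14, 3),
    (7, 1, 19, 5), (7, 1, 20, 4), (7, 1, 21, 2), (7, 1, 22, 1), (7, 2, 5, 4), (7, 2, 11, 5),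
    (7, 4, 8, 10), (7, 4, 11, 9), (7, 7, 8, 3), (7, 7, 8, 9), (7, 7, 9, 9), (7, 7, 10, 1),
    (7, 7, 11, 0), (7, 8, 9, 5), (7, 9, 4, 9), (7, 11, 8, 5), (7, 11, 11, 0), (7, 11, 12, 2),
    (7, 13, 10, 1), (7, 14, 8, 3), (8, 1, 7, 9), (8, 1, 9, 6), (8, 2, 12, 3), (8, 4, 9, 4),
    (8, 5, 7, 9), (8, 5, 9, 3), (8, 7, 7, 9), (9, 1, 2, 17), (9, 1, 4, 13), (9, 1, 7, 8),
    (9, 1, 7, 14), (9, 1, 9, 10), (9, 1, 11, 4), (9, 1, 11, 10), (9, 1, 13, 6), (9, 1, 15, 2),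
    (9, 2, 3, 17), (9, 2, 5, 9), (9, 2, 6, 10), (9, 2, 9, 5), (9, 2, 13, 5), (9, 3, 8, 7),
    (9, 3, 8, 11), (9, 3, 9, 9), (9, 5, 15, 0), (9, 6, 11, 3), (9, 6, 14, 0), (9, 7, 6, 9),
    (9, 7, 9, 0), (9, 7, 15, 0), (9, 8, 10, 5), (9, 9, 1, 4), (9, 9, 1, 10), (9, 9, 2, 5),
    (9, 9, 3, 10), (9, 9, 4, 5), (9, 9, 10, 1), (9, 10, 3, 9), (9, 11, 8, 3), (9, 11, 10, 1),
    (9, 12, 5, 1), (9, 12, 5, 2), (9, 13, 2, 5), (9, 13, 4, 5), (9, 13, 6, 1), (10, 1, 3, 18),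
    (10, 1, 16, 4), (10, 2, 7, 13), (10, 2, 19, 1), (10, 3, 9, 9), (10, 5, 13, 0), (10, 7, 5, 10),
    (10, 7, 15, 0), (10, 9, 2, 10), (11, 1, 10, 3), (11, 1, 12, 5), (11, 1, 13, 5), (11, 2, 7, 9),
    (11, 2, 9, 6), (11, 2, 16, 3), (11, 4, 5, 9), (11, 4, 11, 5), (11, 5, 9, 0), (11, 5, 11, 0),
    (11, 5, 13, 0), (11, 7, 8, 3), (11, 7, 10, 1), (11, 7, 13, 0), (11, 8, 5, 5), (11, 9, 2, 4),
    (11, 9, 2, 9), (11, 10, 2, 6), (11, 12, 2, 6), (12, 1, 7, 9), (12, 1, 11, 5), (12, 3, 9, 3),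
    (12, 3, 9, 5), (12, 4, 7, 9), (12, 9, 2, 4), (13, 1, 12, 3), (13, 1, 13, 4), (13, 2, 7, 9),
    (13, 4, 5, 5), (13, 8, 11, 0), (13, 9, 2, 5), (13, 10, 9, 0), (14, 1, 11, 5), (14, 2, 10, 5),
    (14, 2, 13, 3), (14, 7, 10, 0), (14, 9, 2, 4), (14, 9, 4, 5), (15, 1, 10, 3), (15, 1, 10, 5),
    (15, 1, 12, 4), (15, 7, 9, 0), (15, 8, 9, 0), (15, 9, 5, 0), (16, 1, 9, 3), (16, 3, 10, 3),
    (17, 1, 7, 4), (17, 2, 5, 5), (17, 9, 5, 0), (17, 10, 1, 4), (18, 2, 9, 3), (19, 3, 3, 0),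
    (19, 5, 5, 0)]

lemma rho_f17_mem_hit {j : ℕ} (hj : j < 4) : rho 4 j f17 + f17 ∈ hit 4 := by
  interval_cases j
  · exact rho_f17_add_mem_hit hj hitTerms₀ (by decide +kernel) (by decide +kernel)
      (by decide +kernel)
  · exact rho_f17_add_mem_hit hj hitTerms₁ (by decide +kernel) (by decide +kernel)
      (by decide +kernel)
  · exact rho_f17_add_mem_hit hj hitTerms₂ (by decide +kernel) (by decide +kernel)
      (by decide +kernel)
  · exact rho_f17_add_mem_hit hj hitTerms₃ (by decide +kernel) (by decide +kernel)
      (by decide +kernel)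

end Invariance

/-- `f` is not hit, `ρ_j(f) + f` is hit for each of the four generators `ρ_1, …, ρ_4`
(0-indexed as `rho 4 j`, `j < 4`), and hence the class of `f` is a nonzero
`GL_4(F₂)`-invariant element of `(QP_4)_{33}`. -/
theorem f17_invariant :
    f17 ∉ hit 4 ∧ (∀ j : ℕ, j < 4 → rho 4 j f17 + f17 ∈ hit 4) ∧
      ∀ g : Matrix.GeneralLinearGroup (Fin 4) (ZMod 2),
        psi 4 (g : Matrix (Fin 4) (Fin 4) (ZMod 2)) f17 + f17 ∈ hit 4 := by
  have hrho : ∀ j < 4, rho 4 j ∈ hitStabilizer f17 := fun j hj =>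
    ⟨fun p hp => rho_mem_hit hj hp, rho_f17_mem_hit hj⟩
  refine ⟨f17_notMem_hit, fun j hj => (hrho j hj).2, fun g => ?_⟩
  exact (psi_mem_hitStabilizer hrho ((Matrix.isUnit_iff_isUnit_det _).1 g.isUnit).ne_zero).2
end
end

section
/- Primitivity of the preimage of c₀: let λ : (P_3)_8 → F₂ be the F₂-linear functional defined on the monomial basis by λ(x_1^{a}x_2^{b}x_3^{c}) = 1 if (a,b,c) ∈ {(3,3,2), (3,4,1), (5,2,1), (6,1,1)} and λ(m) = 0 for every other monomial m of degree 8. Then λ vanishes on A⁺P_3 ∩ (P_3)_8; equivalently, λ(Sq^i(g)) = 0 for every i ≥ 1 and every homogeneous g ∈ P_3 of degree 8 − i. (This expresses that the element a_3^{(2)}a_2^{(3)}a_1^{(3)} + a_3^{(1)}a_2^{(4)}a_1^{(3)} + a_3^{(1)}a_2^{(2)}a_1^{(5)} + a_3^{(1)}a_2^{(1)}a_1^{(6)} of the dual divided power algebra is annihilated by all positive-degree Steenrod operations.) -/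
open MvPolynomial

noncomputable section

/-- Exponent vector `(a, b, c)` in three variables. -/
def e3 (a b c : ℕ) : Fin 3 →₀ ℕ :=
  Finsupp.single 0 a + Finsupp.single 1 b + Finsupp.single 2 c

/-- The linear functional on `P_3` taking value 1 exactly on the monomials with exponent
vectors `(3,3,2), (3,4,1), (5,2,1), (6,1,1)` (among the degree-8 monomials). -/
def lam3 : P 3 →ₗ[ZMod 2] ZMod 2 where
  toFun f := coeff (e3 3 3 2) f + coeff (e3 3 4 1) f + coeff (e3 5 2 1) f + coeff (e3 6 1 1) f
  map_add' := by
    intro f g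
    simp [coeff_add]
    ring
  map_smul' := by
    intro c f
    simp [coeff_smul, smul_eq_mul]
    ring

/-- The coefficient of `x ^ p` in `(x + x ^ 2) ^ a`. -/
def sqCoeff (a p : ℕ) : ℕ := if a ≤ p then a.choose (p - a) else 0

theorem X_add_X_sq_pow (k : ℕ) (i : Fin k) (a : ℕ) :
    (X i + X i ^ 2 : P k) ^ a =
      ∑ j ∈ Finset.range (a + 1), monomial (Finsupp.single i (a + j)) (a.choose j : ZMod 2) := by
  have h : (X i + X i ^ 2 : P k) = X i * (X i + 1) := by ring
  rw [h, mul_pow, add_pow, Finset.mul_sum]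
  refine Finset.sum_congr rfl fun j _ => ?_
  rw [← C_mul_X_pow_eq_monomial, pow_add, one_pow, mul_one, map_natCast]
  ring

theorem e3_inj {a b c p q r : ℕ} : e3 a b c = e3 p q r ↔ a = p ∧ b = q ∧ c = r := by
  constructor
  · intro h
    have h0 := DFunLike.congr_fun h 0
    have h1 := DFunLike.congr_fun h 1
    have h2 := DFunLike.congr_fun h 2
    simpa [e3] using And.intro h0 (And.intro h1 h2)
  · rintro ⟨rfl, rfl, rfl⟩
    rfl

theorem sum_choose_ite (a p : ℕ) :
    ∑ j ∈ Finset.range (a + 1), (if a + j = p then (a.choose j : ZMod 2) else 0) =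
      (sqCoeff a p : ZMod 2) := by
  unfold sqCoeff
  split_ifs with h
  · obtain ⟨s, rfl⟩ := Nat.exists_eq_add_of_le h
    simp only [Nat.add_left_cancel_iff, Finset.sum_ite_eq', Finset.mem_range,
      Nat.add_sub_cancel_left]
    split_ifs with hs
    · rfl
    · rw [Nat.choose_eq_zero_of_lt (by omega), Nat.cast_zero]
  · rw [Nat.cast_zero]
    exact Finset.sum_eq_zero fun j _ => if_neg (by omega)

theorem coeff_SqTotal_monomial (m : Fin 3 →₀ ℕ) (t : ZMod 2) (p q r : ℕ) :
    coeff (e3 p q r) (SqTotal 3 (monomial m t)) =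
      t * ((sqCoeff (m 0) p * sqCoeff (m 1) q * sqCoeff (m 2) r : ℕ) : ZMod 2) := by
  have hprod : SqTotal 3 (monomial m t) =
      C t * ((X 0 + X 0 ^ 2) ^ m 0 * (X 1 + X 1 ^ 2) ^ m 1 * (X 2 + X 2 ^ 2) ^ m 2) := by
    rw [SqTotal, aeval_monomial, Finsupp.prod_fintype _ _ (by simp), Fin.prod_univ_three]
    rfl
  rw [hprod, coeff_C_mul, X_add_X_sq_pow, X_add_X_sq_pow, X_add_X_sq_pow, Nat.cast_mul,
    Nat.cast_mul, ← sum_choose_ite, ← sum_choose_ite, ← sum_choose_ite]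
  simp only [Finset.sum_mul, Finset.mul_sum, coeff_sum, monomial_mul]
  congr! 7 with i _ j _ l _
  rw [coeff_monomial]
  change (if e3 _ _ _ = e3 _ _ _ then _ else _) = _
  simp only [e3_inj]
  split_ifs <;> simp_all

theorem sqCoeff_sum_even : ∀ a < 8, ∀ b < 8, ∀ c < 8, a + b + c < 8 →
    (sqCoeff a 3 * sqCoeff b 3 * sqCoeff c 2 + sqCoeff a 3 * sqCoeff b 4 * sqCoeff c 1 +
      sqCoeff a 5 * sqCoeff b 2 * sqCoeff c 1 +
      sqCoeff a 6 * sqCoeff b 1 * sqCoeff c 1) % 2 = 0 := by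
  decide +kernel

theorem lam3_apply (f : P 3) : lam3 f =
    coeff (e3 3 3 2) f + coeff (e3 3 4 1) f + coeff (e3 5 2 1) f + coeff (e3 6 1 1) f :=
  rfl

theorem lam3_SqTotal_monomial (m : Fin 3 →₀ ℕ) (t : ZMod 2) (hm : m.degree < 8) :
    lam3 (SqTotal 3 (monomial m t)) = 0 := by
  rw [Finsupp.degree_eq_sum, Fin.sum_univ_three] at hm
  have h := sqCoeff_sum_even (m 0) (by omega) (m 1) (by omega) (m 2) (by omega) hm
  simp only [lam3_apply, coeff_SqTotal_monomial, ← mul_add, ← Nat.cast_add]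
  rw [(ZMod.natCast_eq_zero_iff _ 2).2 (Nat.dvd_of_mod_eq_zero h), mul_zero]

theorem lam3_SqTotal_of_isHomogeneous {f : P 3} {d : ℕ} (hf : f.IsHomogeneous d) (hd : d < 8) :
    lam3 (SqTotal 3 f) = 0 := by
  rw [f.as_sum, map_sum, map_sum]
  refine Finset.sum_eq_zero fun m hm => lam3_SqTotal_monomial m _ ?_
  rw [Finsupp.degree_eq_weight_one]
  exact (hf (mem_support_iff.1 hm)).trans_lt hd

theorem degree_e3 (a b c : ℕ) : (e3 a b c).degree = a + b + c := by
  simp [e3]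

theorem lam3_homogeneousComponent (n : ℕ) (f : P 3) :
    lam3 (homogeneousComponent n f) = if n = 8 then lam3 f else 0 := by
  simp only [lam3_apply, coeff_homogeneousComponent, degree_e3]
  by_cases h : n = 8
  · simp [h]
  · simp [h, Ne.symm h]

theorem lam3_Sq {n : ℕ} (hn : 1 ≤ n) (g : P 3) : lam3 (Sq 3 n g) = 0 := by
  rw [Sq, map_sum]
  refine Finset.sum_eq_zero fun d _ => ?_
  rw [lam3_homogeneousComponent]
  split_ifs with h
  · exact lam3_SqTotal_of_isHomogeneous (homogeneousComponent_isHomogeneous d g) (by omega)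
  · rfl

/-- Primitivity of the preimage of `c₀`: the functional `λ` vanishes on
`A⁺P_3 ∩ (P_3)_8`; equivalently `λ(Sq^i(g)) = 0` for every `i ≥ 1` and every
homogeneous `g` of degree `8 - i`. -/
theorem lam3_annihilates_hit :
    (∀ u : P 3, u ∈ hit 3 → u ∈ homSub 3 8 → lam3 u = 0) ∧
      (∀ i : ℕ, 1 ≤ i → ∀ g : P 3, g ∈ homSub 3 (8 - i) → lam3 (Sq 3 i g) = 0) := by
  refine ⟨fun u hu _ => ?_, fun i hi g _ => lam3_Sq hi g⟩
  have hle : hit 3 ≤ LinearMap.ker lam3 := by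
    refine Submodule.span_le.2 ?_
    rintro _ ⟨n, hn, g, rfl⟩
    exact lam3_Sq hn g
  exact hle hu
end
end
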